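/- Relation with the Carlitz period (case N = 1): let w ∈ ℕ with (q−1) | w. Then there exist unique elements a_𝔰 ∈ K = 𝔽_q(θ), for 𝔰 ∈ S_w, such that ϖ^{w/(q−1)} + Σ_{𝔰 ∈ S_w} a_𝔰·Li(𝔰) = 0 in K_∞ = 𝔽_q((1/θ)), where Li(𝔰) denotes the Carlitz multiple polylogarithm with all characters equal to 1. -/

import Mathlib

noncomputable section

open scoped Classical

namespace ZHPC

variable (Fq : Type) [Field Fq] [Fintype Fq]

/-- `q`, the cardinality of the base finite field `𝔽_q`. -/
def qc : ℕ := Fintype.card Fq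

/-- The field `K_∞ = 𝔽_q((1/θ))` of formal Laurent series in `1/θ` over `𝔽_q`, modeled as
the field of formal Laurent series in one variable, `θ` being the inverse of that
variable. -/
abbrev KinfQ := LaurentSeries Fq

/-- The element `θ`. -/
def thetaQ : KinfQ Fq := HahnSeries.single (-1 : ℤ) 1

/-- `ℓ_d = ∏_{i=1}^{d} (θ - θ^{q^i})`, with `ℓ_0 = 1`. -/
def ellQ (d : ℕ) : KinfQ Fq := ∏ i ∈ Finset.Icc 1 d, (thetaQ Fq - thetaQ Fq ^ qc Fq ^ i)

/-- The Carlitz multiple polylogarithm (with all characters equal to `1`)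
`Li(𝔰) = Σ_{d₁ > ⋯ > d_n ≥ 0} 1/(ℓ_{d₁}^{s₁}⋯ℓ_{d_n}^{s_n})`. -/
def LiQ (n : ℕ) (s : Fin n → ℕ) : KinfQ Fq :=
  ∑' d : {f : Fin n → ℕ // StrictAnti f}, ∏ i, 1 / ellQ Fq (d.1 i) ^ s i

/-- `ϖ = (-θ)^q · ∏_{i ≥ 1} (1 - θ^{1-q^i})^{-(q-1)}`, the `(q-1)`-st power of the Carlitz
period `π̃`. -/
def piQ : KinfQ Fq :=
  (-thetaQ Fq) ^ qc Fq *
    ∏' i : ℕ, (1 - thetaQ Fq ^ ((1 : ℤ) - (qc Fq : ℤ) ^ (i + 1))) ^ (-((qc Fq : ℤ) - 1))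

/-- The field `K = 𝔽_q(θ)`, as a subfield of `K_∞`. -/
def Ksub : Subfield (KinfQ Fq) :=
  Subfield.closure ((Set.range fun x : Fq => (HahnSeries.C x : KinfQ Fq)) ∪ {thetaQ Fq})

/-- The set `S_w` of tuples `𝔰 = (s₁,…,s_n) ∈ ℕⁿ` (`n ≥ 1`) of weight `w` with `q ∤ sᵢ`
for all `i`. -/
def STup (Q w : ℕ) : Type :=
  {p : Σ n : ℕ, Fin n → ℕ // 0 < p.1 ∧ (∀ i, 0 < p.2 i) ∧ (∑ i, p.2 i) = w ∧ ∀ i, ¬ Q ∣ p.2 i}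

set_option linter.unusedSectionVars false

section basics
open Filter Topology

variable {F : Type} [Field F]

/-- degree at most `n`. -/
def dle (x : KinfQ F) (n : ℤ) : Prop := Valued.v x ≤ (WithZero.exp n : WithZero (Multiplicative ℤ))

lemma dle_iff {x : KinfQ F} {n : ℤ} : dle x n ↔ ∀ m < -n, x.coeff m = 0 := by
  have := LaurentSeries.valuation_le_iff_coeff_lt_eq_zero F (D := -n) (f := x)
  rw [neg_neg] at this
  exact this

lemma dle_zero (n : ℤ) : dle (0 : KinfQ F) n := by simp [dle]
lemma dle_mono {x : KinfQ F} {n m : ℤ} (h : dle x n) (hnm : n ≤ m) : dle x m :=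
  le_trans h (by simpa using hnm)
lemma dle_add {x y : KinfQ F} {n : ℤ} (hx : dle x n) (hy : dle y n) : dle (x + y) n :=
  le_trans (Valuation.map_add _ _ _) (max_le hx hy)
lemma dle_neg {x : KinfQ F} {n : ℤ} (hx : dle x n) : dle (-x) n := by
  unfold dle; rw [Valuation.map_neg]; exact hx
lemma dle_sub {x y : KinfQ F} {n : ℤ} (hx : dle x n) (hy : dle y n) : dle (x - y) n := by
  rw [sub_eq_add_neg]; exact dle_add hx (dle_neg hy)
lemma dle_mul {x y : KinfQ F} {n m : ℤ} (hx : dle x n) (hy : dle y m) : dle (x * y) (n + m) := by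
  unfold dle; rw [map_mul, WithZero.exp_add]; exact mul_le_mul' hx hy
lemma dle_one : dle (1 : KinfQ F) 0 := by simp [dle]
lemma dle_pow {x : KinfQ F} {n : ℤ} (hx : dle x n) (k : ℕ) : dle (x ^ k) (k * n) := by
  induction k with
  | zero => simpa using dle_one
  | succ k ih => rw [pow_succ]; convert dle_mul ih hx using 1; push_cast; ring
lemma dle_sum {ι : Type*} (S : Finset ι) {f : ι → KinfQ F} {n : ℤ} (h : ∀ i ∈ S, dle (f i) n) :
    dle (∑ i ∈ S, f i) n := Valuation.map_sum_le _ h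

lemma dle_C (a : F) : dle (HahnSeries.C a : KinfQ F) 0 := by
  rw [dle_iff]; intro m hm
  rw [HahnSeries.C_apply, HahnSeries.coeff_single_of_ne]; omega

lemma v_theta : Valued.v (thetaQ F) = (WithZero.exp 1 : WithZero (Multiplicative ℤ)) := by
  have := LaurentSeries.valuation_single_zpow F (-1)
  rw [neg_neg] at this
  exact this

lemma theta_ne : thetaQ F ≠ 0 := by simp [thetaQ]

lemma v_theta_zpow (n : ℤ) : Valued.v (thetaQ F ^ n) = (WithZero.exp n : WithZero (Multiplicative ℤ)) := by
  rw [map_zpow₀, v_theta, ← WithZero.exp_zsmul]; simp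

lemma v_theta_pow (n : ℕ) : Valued.v (thetaQ F ^ n) = (WithZero.exp (n:ℤ) : WithZero (Multiplicative ℤ)) := by
  rw [← v_theta_zpow (F := F), zpow_natCast]

lemma dle_theta_zpow (n : ℤ) : dle (thetaQ F ^ n) n := (v_theta_zpow n).le
lemma dle_theta_pow (n : ℕ) : dle (thetaQ F ^ n) n := (v_theta_pow n).le
lemma dle_theta : dle (thetaQ F) 1 := v_theta.le

lemma one_lt_qc [Fintype F] : 1 < qc F := Fintype.one_lt_card

lemma v_sub_theta {n : ℕ} (hn : 1 < n) :
    Valued.v (thetaQ F - thetaQ F ^ n) = (WithZero.exp (n:ℤ) : WithZero (Multiplicative ℤ)) := by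
  rw [Valuation.map_sub_eq_of_lt_right, v_theta_pow]
  rw [v_theta_pow, v_theta]
  simpa using hn

lemma sub_theta_ne {n : ℕ} (hn : 1 < n) : thetaQ F - thetaQ F ^ n ≠ 0 := by
  intro h
  have := v_sub_theta (F := F) hn
  rw [h, map_zero] at this
  exact WithZero.exp_ne_zero this.symm

lemma dle_inv_sub {n : ℕ} (hn : 1 < n) : dle (1 / (thetaQ F - thetaQ F ^ n)) (-n) := by
  unfold dle
  rw [one_div, map_inv₀, v_sub_theta hn, WithZero.exp_neg]

lemma nhds_iff {ι : Type*} {l : Filter ι} {f : ι → KinfQ F} {y : KinfQ F} :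
    Tendsto f l (𝓝 y) ↔ ∀ n : ℤ, ∀ᶠ b in l, dle (f b - y) n := by
  constructor
  · intro h n
    have : {z : KinfQ F | dle (z - y) n} ∈ 𝓝 y := by
      rw [Valued.mem_nhds]
      have hne : Valued.v.restrict (thetaQ F ^ (n)) ≠ 0 := by
        rw [Valuation.ne_zero_iff]; exact zpow_ne_zero _ theta_ne
      refine ⟨Units.mk0 _ hne, ?_⟩
      intro z hz
      simp only [Set.mem_ofPred_eq, Units.val_mk0] at hz ⊢
      have := (Valuation.restrict_lt_iff _).1 hz
      rw [v_theta_zpow] at this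
      exact this.le
    exact h this
  · intro h
    rw [tendsto_def]
    intro s hs
    rw [Valued.mem_nhds] at hs
    obtain ⟨γ, hγ⟩ := hs
    set e := MonoidWithZeroHom.ValueGroup₀.embedding γ.1 with he
    have hz0 : e ≠ 0 := by
      rw [he, map_ne_zero_iff _ MonoidWithZeroHom.ValueGroup₀.embedding_injective]
      exact γ.ne_zero
    obtain ⟨n, hn⟩ : ∃ n : ℤ, (WithZero.exp n : WithZero (Multiplicative ℤ)) < e := by
      refine ⟨WithZero.log e - 1, ?_⟩
      rw [← WithZero.lt_log_iff_exp_lt hz0]; omega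
    filter_upwards [h n] with b hb
    apply hγ
    simp only [Set.mem_ofPred_eq]
    rw [Valuation.restrict_lt_iff_lt_embedding]
    exact lt_of_le_of_lt hb hn

lemma eq_zero_of_dle {x : KinfQ F} (h : ∀ n : ℤ, dle x n) : x = 0 := by
  ext m
  exact dle_iff.1 (h (-(m+1))) m (by omega)

lemma dle_of_tendsto {ι : Type*} {l : Filter ι} [l.NeBot] {f : ι → KinfQ F} {y : KinfQ F} {n : ℤ}
    (h : Tendsto f l (𝓝 y)) (hf : ∀ᶠ b in l, dle (f b) n) : dle y n := by
  obtain ⟨b, h1, h2⟩ := ((nhds_iff.1 h n).and hf).exists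
  have := dle_sub h2 h1
  simpa using this

lemma lim_exists {f : ℕ → KinfQ F} (h0 : ∀ b, dle (f b) 0)
    (h : ∀ b : ℕ, dle (f (b+1) - f b) (-b)) : ∃ y, ∀ b : ℕ, dle (f b - y) (-b) := by
  have key : ∀ (m : ℤ) (b : ℕ), m.toNat + 1 ≤ b → (f b).coeff m = (f (m.toNat+1)).coeff m := by
    intro m b hb
    induction b, hb using Nat.le_induction with
    | base => rfl
    | succ b hb ih =>
      rw [← ih]
      have := dle_iff.1 (h b) m (by omega)
      rw [HahnSeries.coeff_sub] at this
      exact sub_eq_zero.1 this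
  have hbdd : BddBelow (Function.support fun m : ℤ => (f (m.toNat+1)).coeff m) := by
    refine ⟨0, fun m hm => ?_⟩
    by_contra hlt
    exact (Function.mem_support.1 hm) (dle_iff.1 (h0 _) m (by omega))
  refine ⟨HahnSeries.ofSuppBddBelow (fun m => (f (m.toNat+1)).coeff m) hbdd, ?_⟩
  · intro b
    rw [dle_iff]
    intro m hm
    rw [HahnSeries.coeff_sub, HahnSeries.ofSuppBddBelow_coeff, sub_eq_zero]
    by_cases hm0 : m < 0
    · rw [dle_iff.1 (h0 _) m (by omega), dle_iff.1 (h0 _) m (by omega)]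
    · exact key m b (by omega)

lemma tendsto_of_dle {f : ℕ → KinfQ F} {y : KinfQ F} (h : ∀ b : ℕ, dle (f b - y) (-b)) :
    Tendsto f atTop (𝓝 y) := by
  rw [nhds_iff]
  intro n
  filter_upwards [eventually_ge_atTop (-n).toNat] with b hb
  exact dle_mono (h b) (by omega)
end basics

section Udef
open Filter Topology
/-- truncated multiple sums. -/
def U {A : Type*} [CommRing A] (x : ℕ → A) : List ℕ → ℕ → A
  | [], _ => 1
  | k :: s, b => ∑ d ∈ Finset.range b, x d ^ k * U x s d

variable {A : Type*} [CommRing A] (x : ℕ → A)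

lemma U_nil (b : ℕ) : U x [] b = 1 := by simp [U]
lemma U_cons (k : ℕ) (s : List ℕ) (b : ℕ) :
    U x (k :: s) b = ∑ d ∈ Finset.range b, x d ^ k * U x s d := by rw [U]
lemma U_cons_zero (k : ℕ) (s : List ℕ) : U x (k :: s) 0 = 0 := by simp [U_cons]
lemma U_cons_succ (k : ℕ) (s : List ℕ) (b : ℕ) :
    U x (k :: s) (b+1) = U x (k :: s) b + x b ^ k * U x s b := by
  rw [U_cons, U_cons, Finset.sum_range_succ]

lemma U_zero {s : List ℕ} (hs : s ≠ []) : U x s 0 = 0 := by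
  cases s with
  | nil => exact absurd rfl hs
  | cons k s => exact U_cons_zero x k s

lemma U_map {B : Type*} [CommRing B] (f : A →+* B) (s : List ℕ) (b : ℕ) :
    f (U x s b) = U (fun d => f (x d)) s b := by
  induction s generalizing b with
  | nil => simp [U_nil]
  | cons k s ih => simp [U_cons, ih]

lemma U_step (x' : ℕ → A) (m : A) (h0 : x 0 = 1) (h1 : ∀ d, x (d+1) = m * x' d)
    (s : List ℕ) (k b : ℕ) :
    U x (s ++ [k]) (b+1) = m ^ (s.sum + k) * U x' (s ++ [k]) b + m ^ s.sum * U x' s b := by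
  induction s generalizing b with
  | nil =>
    simp only [List.nil_append, U_cons, U_nil, Finset.sum_range_succ', h0, h1, mul_pow, Finset.mul_sum]
    simp
  | cons j s ih =>
    rw [List.cons_append, U_cons, Finset.sum_range_succ', U_zero x (by simp : s ++ [k] ≠ []), mul_zero,
      add_zero, U_cons, U_cons, Finset.mul_sum, Finset.mul_sum, ← Finset.sum_add_distrib]
    refine Finset.sum_congr rfl fun d _ => ?_
    rw [ih, h1]
    simp only [List.sum_cons]
    ring

variable {F : Type} [Field F] {x : ℕ → KinfQ F}

lemma U_dle (hx : ∀ d : ℕ, dle (x d) (-d)) (s : List ℕ) (b : ℕ) : dle (U x s b) 0 := by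
  induction s generalizing b with
  | nil => rw [U_nil]; exact dle_one
  | cons k s ih =>
    rw [U_cons]
    refine dle_sum _ fun d _ => ?_
    have := dle_mul (dle_pow (hx d) k) (ih d)
    refine dle_mono this ?_
    simp only [mul_neg, add_zero, Left.neg_nonpos_iff]; positivity

lemma term_dle (hx : ∀ d : ℕ, dle (x d) (-d)) {k : ℕ} (hk : 0 < k) {y : KinfQ F} (hy : dle y 0) (d : ℕ) :
    dle (x d ^ k * y) (-d) := by
  refine dle_mono (dle_mul (dle_pow (hx d) k) hy) ?_
  have : (d:ℤ) ≤ k * d := by exact_mod_cast Nat.le_mul_of_pos_left d hk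
  simpa using this

/-- limit. -/
def Ulim (x : ℕ → KinfQ F) (s : List ℕ) : KinfQ F := limUnder atTop (U x s)

lemma Ulim_spec (hx : ∀ d : ℕ, dle (x d) (-d)) {s : List ℕ} (hs : ∀ k ∈ s, 0 < k) (b : ℕ) :
    dle (U x s b - Ulim x s) (-b) := by
  have : ∃ y, ∀ b : ℕ, dle (U x s b - y) (-b) := by
    refine lim_exists (U_dle hx s) fun b => ?_
    cases s with
    | nil => simp only [U_nil, sub_self]; exact dle_zero _
    | cons k s =>
      rw [U_cons_succ, add_sub_cancel_left]
      exact term_dle hx (hs k (by simp)) (U_dle hx s b) b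
  obtain ⟨y, hy⟩ := this
  rw [Ulim, (tendsto_of_dle hy).limUnder_eq]
  exact hy b

lemma Ulim_tendsto (hx : ∀ d : ℕ, dle (x d) (-d)) {s : List ℕ} (hs : ∀ k ∈ s, 0 < k) :
    Tendsto (U x s) atTop (𝓝 (Ulim x s)) := tendsto_of_dle (Ulim_spec hx hs)

lemma Ulim_dle (hx : ∀ d : ℕ, dle (x d) (-d)) {s : List ℕ} (hs : ∀ k ∈ s, 0 < k) : dle (Ulim x s) 0 :=
  dle_of_tendsto (Ulim_tendsto hx hs) (Eventually.of_forall (U_dle hx s))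

lemma Ulim_nil (hx : ∀ d : ℕ, dle (x d) (-d)) : Ulim x [] = 1 := by
  have h := Ulim_tendsto hx (s := []) (by simp)
  have h2 : U x [] = fun _ => 1 := by ext1 b; rw [U_nil]
  rw [h2] at h
  exact tendsto_nhds_unique h tendsto_const_nhds

lemma Ulim_step {x x' : ℕ → KinfQ F} (hx : ∀ d : ℕ, dle (x d) (-d)) (hx' : ∀ d : ℕ, dle (x' d) (-d))
    (m : KinfQ F) (h0 : x 0 = 1) (h1 : ∀ d, x (d+1) = m * x' d)
    (s : List ℕ) (k : ℕ) (hs : ∀ k ∈ s, 0 < k) (hk : 0 < k) :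
    Ulim x (s ++ [k]) = m ^ (s.sum + k) * Ulim x' (s ++ [k]) + m ^ s.sum * Ulim x' s := by
  have hsk : ∀ j ∈ s ++ [k], 0 < j := by
    intro j hj; simp at hj; rcases hj with h | h
    · exact hs j h
    · omega
  have t1 := (tendsto_add_atTop_iff_nat 1).2 (Ulim_tendsto hx hsk)
  have t2 := ((Ulim_tendsto hx' hsk).const_mul (m ^ (s.sum + k))).add
    ((Ulim_tendsto hx' hs).const_mul (m ^ s.sum))
  refine tendsto_nhds_unique t1 (t2.congr fun b => ?_)
  rw [U_step x x' m h0 h1]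
end Udef

section LiSec
open Filter Topology
variable {F : Type} [Field F] {x : ℕ → KinfQ F}

lemma U_eq_sum (x : ℕ → KinfQ F) : ∀ (n : ℕ) (s : Fin n → ℕ) (b : ℕ),
    U x (List.ofFn s) b = ∑ f ∈ (Fintype.piFinset fun _ : Fin n => Finset.range b).filter StrictAnti,
      ∏ i, x (f i) ^ s i := by
  intro n
  induction n with
  | zero =>
    intro s b
    rw [List.ofFn_zero, U_nil, Finset.filter_true_of_mem]
    · simp
    · intro f _ i; exact i.elim0
  | succ n ih =>
    intro s b
    rw [List.ofFn_succ, U_cons]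
    simp_rw [ih, Finset.mul_sum]
    rw [Finset.sum_sigma']
    refine Finset.sum_bij' (fun p _ => Fin.cons p.1 p.2) (fun f _ => ⟨f 0, Fin.tail f⟩) ?_ ?_ ?_ ?_ ?_
    · rintro ⟨d, g⟩ h
      simp only [Finset.mem_sigma, Finset.mem_range, Finset.mem_filter, Fintype.mem_piFinset] at h ⊢
      refine ⟨?_, ?_⟩
      · intro i
        refine Fin.cases ?_ (fun i => ?_) i
        · simpa using h.1
        · have := h.2.1 i; simp; omega
      · intro i j hij
        induction j using Fin.cases with
        | zero => exact absurd hij (by simp)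
        | succ j =>
          induction i using Fin.cases with
          | zero => simpa using h.2.1 j
          | succ i => simpa using h.2.2 (by simpa using hij)
    · intro f h
      simp only [Finset.mem_sigma, Finset.mem_range, Finset.mem_filter, Fintype.mem_piFinset] at h ⊢
      refine ⟨h.1 0, fun i => h.2 (Fin.succ_pos i), fun i j hij => h.2 (by simpa using hij)⟩
    · rintro ⟨d, g⟩ h
      simp
    · intro f h
      simp
    · rintro ⟨d, g⟩ h
      rw [Fin.prod_univ_succ]
      simp

lemma prod_dle (hx : ∀ d : ℕ, dle (x d) (-d)) (n : ℕ) (s f : Fin n → ℕ) (hs : ∀ i, 0 < s i) (i : Fin n) :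
    dle (∏ i, x (f i) ^ s i) (-(f i)) := by
  have h0 : ∀ S : Finset (Fin n), dle (∏ i ∈ S, x (f i) ^ s i) 0 := by
    intro S
    induction S using Finset.induction_on with
    | empty => simpa using dle_one
    | insert a S ha ih =>
      rw [Finset.prod_insert ha]
      exact dle_mono (term_dle hx (hs a) ih (f a)) (by simp)
  rw [← Finset.mul_prod_erase _ _ (Finset.mem_univ i)]
  exact term_dle hx (hs i) (h0 _) (f i)

lemma hasSum_Ulim (hx : ∀ d : ℕ, dle (x d) (-d)) (n : ℕ) (s : Fin n → ℕ) (hs : ∀ i, 0 < s i) :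
    HasSum (fun d : {f : Fin n → ℕ // StrictAnti f} => ∏ i, x (d.1 i) ^ s i) (Ulim x (List.ofFn s)) := by
  have hs' : ∀ k ∈ List.ofFn s, 0 < k := by
    intro k hk; rw [List.mem_ofFn'] at hk; obtain ⟨i, rfl⟩ := hk; exact hs i
  unfold HasSum
  rw [SummationFilter.unconditional_filter, nhds_iff]
  intro N
  set b : ℕ := (-N).toNat with hb
  set S : Finset {f : Fin n → ℕ // StrictAnti f} :=
    ((Fintype.piFinset fun _ : Fin n => Finset.range b)).subtype StrictAnti with hS
  filter_upwards [eventually_ge_atTop S] with T hT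
  have e1 : ∑ d ∈ S, ∏ i, x (d.1 i) ^ s i = U x (List.ofFn s) b := by
    rw [U_eq_sum, ← Finset.sum_subtype_eq_sum_filter]
  have e2 := Finset.sum_sdiff (f := fun d : {f : Fin n → ℕ // StrictAnti f} => ∏ i, x (d.1 i) ^ s i) hT
  rw [← e2, e1, add_sub_assoc]
  refine dle_add (dle_sum _ fun d hd => ?_) (dle_mono (Ulim_spec hx hs' b) (by omega))
  simp only [hS, Finset.mem_sdiff, Finset.mem_subtype, Fintype.mem_piFinset, Finset.mem_range, not_forall] at hd
  obtain ⟨_, i, hi⟩ := hd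
  exact dle_mono (prod_dle hx n s d.1 hs i) (by omega)
end LiSec

section Xdef
variable (F : Type) [Field F] [Fintype F]
/-- the twisted inverse `ℓ`. -/
def xs (ν d : ℕ) : KinfQ F := ∏ i ∈ Finset.range d, 1 / (thetaQ F - thetaQ F ^ qc F ^ (i + 1 + ν))

lemma xs_zero (ν : ℕ) : xs F ν 0 = 1 := by simp [xs]
lemma one_lt_pow (n : ℕ) : 1 < qc F ^ (n+1) := Nat.one_lt_pow (by omega) one_lt_qc
lemma xs_succ (ν d : ℕ) : xs F ν (d+1) = 1 / (thetaQ F - thetaQ F ^ qc F ^ (ν + 1)) * xs F (ν+1) d := by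
  rw [xs, xs, Finset.prod_range_succ', mul_comm]
  congr 1
  · rw [show 0 + 1 + ν = ν + 1 by ring]
  · refine Finset.prod_congr rfl fun i _ => ?_
    rw [show i + 1 + 1 + ν = i + 1 + (ν + 1) by ring]
lemma xs_dle (ν d : ℕ) : dle (xs F ν d) (-d) := by
  induction d generalizing ν with
  | zero => rw [xs_zero]; exact dle_one
  | succ d ih =>
    rw [xs_succ]
    refine dle_mono (dle_mul (dle_inv_sub (one_lt_pow F ν)) (ih (ν+1))) ?_
    have := one_lt_pow F ν
    push_cast
    have : (1:ℤ) < (qc F:ℤ) ^ (ν+1) := by exact_mod_cast this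
    linarith
lemma xs_eq (d : ℕ) : 1 / ellQ F d = xs F 0 d := by
  rw [ellQ, xs, Finset.prod_div_distrib, Finset.prod_const_one, Finset.range_eq_Ico,
    Finset.prod_Ico_add' (fun i => thetaQ F - thetaQ F ^ qc F ^ (i + 0)) 0 d 1]
  rfl

lemma LiQ_eq (n : ℕ) (s : Fin n → ℕ) (hs : ∀ i, 0 < s i) : LiQ F n s = Ulim (xs F 0) (List.ofFn s) := by
  rw [LiQ, ← (hasSum_Ulim (xs_dle F 0) n s hs).tsum_eq]
  refine tsum_congr fun d => Finset.prod_congr rfl fun i _ => ?_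
  rw [← xs_eq, div_pow, one_pow]
end Xdef

section exist1
open Filter Topology
variable (F : Type) [Field F] [Fintype F]

lemma q_pow_sub (a b : KinfQ F) : (a - b) ^ qc F = a ^ qc F - b ^ qc F :=
  map_sub (FiniteField.frobeniusAlgHom F (KinfQ F)) a b

/-- `θ - θ^q`. -/
def DD : KinfQ F := thetaQ F - thetaQ F ^ qc F

lemma DD_ne : DD F ≠ 0 := sub_theta_ne one_lt_qc

/-- `θ - θ^(q^(d+1))`. -/
def TT (d : ℕ) : KinfQ F := thetaQ F - thetaQ F ^ qc F ^ (d + 1)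
lemma TT_ne (d : ℕ) : TT F d ≠ 0 := sub_theta_ne (one_lt_pow F d)
lemma TT_zero : TT F 0 = DD F := by simp [TT, DD]
lemma TT_pow (d : ℕ) : TT F d ^ qc F + DD F = TT F (d+1) := by
  rw [TT, q_pow_sub, ← pow_mul, ← pow_succ, TT, DD]; ring

lemma xs_succ' (d : ℕ) : xs F 0 (d+1) * TT F d = xs F 0 d := by
  rw [xs, Finset.prod_range_succ, ← xs, add_zero, ← TT, mul_assoc, one_div,
    inv_mul_cancel₀ (TT_ne F d), mul_one]

lemma q_pred : qc F - 1 + 1 = qc F := by have := one_lt_qc (F := F); omega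

lemma x_pow_q (d : ℕ) : xs F 0 d ^ qc F = DD F * xs F 0 (d+1) * U (xs F 0) [qc F - 1] (d+1) := by
  induction d with
  | zero =>
    have := xs_succ' F 0
    rw [TT_zero] at this
    rw [U_cons, Finset.sum_range_one, U_nil, mul_comm (DD F), this, xs_zero]; simp
  | succ d ih =>
    have h1 := xs_succ' F d
    have h2 := xs_succ' F (d+1)
    have h3 := TT_pow F d
    rw [U_cons_succ, U_nil, mul_add, mul_one]
    apply mul_right_cancel₀ (TT_ne F (d+1))
    have e : (DD F * xs F 0 (d + 1 + 1) * U (xs F 0) [qc F - 1] (d + 1) +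
        DD F * xs F 0 (d + 1 + 1) * xs F 0 (d + 1) ^ (qc F - 1)) * TT F (d + 1)
        = DD F * xs F 0 (d+1) * U (xs F 0) [qc F - 1] (d + 1) + DD F * xs F 0 (d + 1) ^ qc F := by
      rw [← q_pred F, pow_succ, Nat.add_sub_cancel]
      linear_combination (DD F * U (xs F 0) [qc F - 1] (d + 1) + DD F * xs F 0 (d + 1) ^ (qc F - 1)) * h2
    rw [e, ← ih, ← h1, mul_pow, ← h3]
    ring

lemma xs_ne (d : ℕ) : xs F 0 d ≠ 0 := by
  induction d with
  | zero => rw [xs_zero]; exact one_ne_zero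
  | succ d ih => intro h; have := xs_succ' F d; rw [h, zero_mul] at this; exact ih this.symm

/-- `1 - θ^{1-q^(i+1)}`. -/
def uu (i : ℕ) : KinfQ F := 1 - thetaQ F ^ ((1 : ℤ) - (qc F : ℤ) ^ (i + 1))

lemma TT_eq (i : ℕ) : TT F i = - (thetaQ F ^ qc F ^ (i+1) * uu F i) := by
  rw [uu, mul_sub, mul_one, ← zpow_natCast (thetaQ F) (qc F ^ (i+1)), ← zpow_add₀ theta_ne, TT]
  push_cast
  rw [add_sub_cancel, zpow_one, ← zpow_natCast (thetaQ F) (qc F ^ (i+1))]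
  push_cast
  ring

lemma uu_dle (i : ℕ) : dle (uu F i - 1) (-(i+1)) := by
  rw [uu, sub_sub_cancel_left]
  refine dle_neg (dle_mono (dle_theta_zpow _) ?_)
  have h2 : 2 ≤ qc F := one_lt_qc
  have h : i + 1 < qc F ^ (i+1) := lt_of_lt_of_le Nat.lt_two_pow_self (Nat.pow_le_pow_left h2 _)
  have : ((i:ℤ)+1) < (qc F : ℤ)^(i+1) := by exact_mod_cast h
  linarith

lemma v_one_of {z : KinfQ F} {n : ℤ} (hn : n < 0) (h : dle (z - 1) n) : Valued.v z = (1 : WithZero (Multiplicative ℤ)) := by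
  have : Valued.v (z - 1 + 1) = (Valued.v (1 : KinfQ F)) := by
    apply Valuation.map_add_eq_of_lt_right
    rw [map_one]
    refine lt_of_le_of_lt h ?_
    rw [← WithZero.exp_zero]; exact WithZero.exp_lt_exp.2 hn
  simpa using this

lemma uu_v (i : ℕ) : Valued.v (uu F i) = (1 : WithZero (Multiplicative ℤ)) :=
  v_one_of F (by omega : (-((i:ℤ)+1)) < 0) (uu_dle F i)
lemma uu_ne (i : ℕ) : uu F i ≠ 0 := by
  intro h; have := uu_v F i; rw [h, map_zero] at this; exact zero_ne_one this

/-- factors of the product. -/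
def gg (i : ℕ) : KinfQ F := uu F i ^ (-((qc F : ℤ) - 1))
lemma gg_eq (i : ℕ) : gg F i = (uu F i)⁻¹ ^ (qc F - 1) := by
  rw [gg, zpow_neg, inv_pow, ← zpow_natCast, Nat.cast_sub one_lt_qc.le, Nat.cast_one]
lemma gg_mul (i : ℕ) : gg F i * uu F i ^ (qc F - 1) = 1 := by
  rw [gg_eq, ← mul_pow, inv_mul_cancel₀ (uu_ne F i), one_pow]

lemma one_mul_dle {a b : KinfQ F} {n : ℤ} (hn : n < 0) (ha : dle (a-1) n) (hb : dle (b - 1) n) :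
    dle (a * b - 1) n := by
  have : a * b - 1 = a * (b - 1) + (a - 1) := by ring
  rw [this]
  refine dle_add ?_ ha
  have h := dle_mul (n := 0) (le_of_eq ?_ : dle a 0) hb
  · simpa using h
  · rw [v_one_of F hn ha, WithZero.exp_zero]

lemma gg_dle (i : ℕ) : dle (gg F i - 1) (-(i+1)) := by
  rw [gg_eq]
  have hn : (-((i:ℤ)+1)) < 0 := by omega
  have h1 : dle ((uu F i)⁻¹ - 1) (-(i+1)) := by
    have : (uu F i)⁻¹ - 1 = (uu F i)⁻¹ * (-(uu F i - 1)) := by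
      have := inv_mul_cancel₀ (uu_ne F i); linear_combination this
    rw [this]
    have h := dle_mul (n := 0) (le_of_eq ?_ : dle (uu F i)⁻¹ 0) (dle_neg (uu_dle F i))
    · simpa using h
    · rw [map_inv₀, uu_v, inv_one, WithZero.exp_zero]
  generalize qc F - 1 = n
  induction n with
  | zero => simp only [pow_zero, sub_self]; exact dle_zero _
  | succ n ih => rw [pow_succ]; exact one_mul_dle F hn ih h1

lemma prod_gg_dle (S : Finset ℕ) (b : ℕ) (h : ∀ i ∈ S, b ≤ i) : dle (∏ i ∈ S, gg F i - 1) (-(b+1)) := by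
  induction S using Finset.induction_on with
  | empty => simp only [Finset.prod_empty, sub_self]; exact dle_zero _
  | insert a S ha ih =>
    rw [Finset.prod_insert ha]
    have hn : (-((b:ℤ)+1)) < 0 := by omega
    refine one_mul_dle F hn (dle_mono (gg_dle F a) ?_) (ih fun i hi => h i (by simp [hi]))
    have := h a (by simp)
    omega

lemma hasProd_gg {y : KinfQ F} (h : Tendsto (fun b => ∏ i ∈ Finset.range b, gg F i) atTop (𝓝 y)) :
    HasProd (gg F) y := by
  unfold HasProd
  rw [SummationFilter.unconditional_filter, nhds_iff]
  intro N
  obtain ⟨b, h1, h2⟩ := ((nhds_iff.1 h N).and (eventually_ge_atTop (-N).toNat)).exists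
  filter_upwards [eventually_ge_atTop (Finset.range b)] with T hT
  rw [← Finset.prod_sdiff hT]
  have e : (∏ i ∈ T \ Finset.range b, gg F i) * ∏ i ∈ Finset.range b, gg F i - y =
    (∏ i ∈ T \ Finset.range b, gg F i - 1) * ∏ i ∈ Finset.range b, gg F i
    + (∏ i ∈ Finset.range b, gg F i - y) := by ring
  rw [e]
  refine dle_add ?_ h1
  have h3 := prod_gg_dle F (T \ Finset.range b) b (by intro i hi; simp at hi; exact hi.2)
  have h4 := prod_gg_dle F (Finset.range b) 0 (by simp)
  have h5 : dle (∏ i ∈ Finset.range b, gg F i) 0 := by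
    refine le_of_eq ?_
    rw [v_one_of F (by omega) h4, WithZero.exp_zero]
  refine dle_mono (dle_mul h3 h5) (by omega)

lemma neg_one_q : (-1 : KinfQ F) ^ qc F = -1 := by
  have := q_pow_sub F 0 1
  have hq : qc F ≠ 0 := by have := one_lt_qc (F := F); omega
  simpa [hq] using this

lemma DU_eq (d : ℕ) : DD F * U (xs F 0) [qc F - 1] (d+1) = 
    (-thetaQ F) ^ qc F * (∏ i ∈ Finset.range d, gg F i) * uu F d := by
  have e1 : ∀ d, DD F * U (xs F 0) [qc F - 1] (d+1) = xs F 0 d ^ (qc F - 1) * TT F d := by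
    intro d
    apply mul_right_cancel₀ (xs_ne F (d+1))
    have := x_pow_q F d
    rw [mul_assoc (xs F 0 d ^ (qc F - 1)), mul_comm (TT F d), xs_succ', ← pow_succ, q_pred, this]; ring
  rw [e1]
  induction d with
  | zero =>
    simp [xs_zero, TT_eq, neg_pow (thetaQ F) (qc F), neg_one_q]
  | succ d ih =>
    rw [Finset.prod_range_succ]
    have hne : TT F d ^ qc F ≠ 0 := pow_ne_zero _ (TT_ne F d)
    apply mul_right_cancel₀ hne
    have e2 : xs F 0 (d+1) ^ (qc F - 1) * TT F (d+1) * TT F d ^ qc F =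
      (xs F 0 d ^ (qc F - 1) * TT F d) * TT F (d+1) := by
      rw [← xs_succ' F d, mul_pow]
      nth_rw 2 [← q_pred F]
      rw [pow_succ]; ring
    have e3 : TT F d ^ qc F = - (thetaQ F ^ qc F ^ (d+1+1) * uu F d ^ (qc F)) := by
      rw [TT_eq, neg_pow, neg_one_q, mul_pow, ← pow_mul, ← pow_succ]; ring
    have e4 := gg_mul F d
    have e5 : uu F d ^ qc F = uu F d ^ (qc F - 1) * uu F d := by rw [← pow_succ, q_pred]
    rw [e2, ih, e3, TT_eq F (d+1), e5]
    linear_combination (-(-thetaQ F) ^ qc F * (∏ i ∈ Finset.range d, gg F i) * uu F (d+1) * uu F d * thetaQ F ^ qc F ^ (d+1+1)) * -e4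

lemma pos_single {k : ℕ} (hk : 0 < k) : ∀ j ∈ [k], 0 < j := by simpa using hk

lemma piQ_eq : piQ F = DD F * Ulim (xs F 0) [qc F - 1] := by
  have hq : 0 < qc F - 1 := by have := one_lt_qc (F := F); omega
  have hth : (-thetaQ F) ^ qc F ≠ 0 := pow_ne_zero _ (neg_ne_zero.2 theta_ne)
  have t1 := (tendsto_add_atTop_iff_nat 1).2 (Ulim_tendsto (xs_dle F 0) (pos_single hq))
  have tu : Tendsto (uu F) atTop (𝓝 1) := by
    apply tendsto_of_dle; intro b; exact dle_mono (uu_dle F b) (by omega)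
  have t2 : Tendsto (fun b => ∏ i ∈ Finset.range b, gg F i) atTop
      (𝓝 (((-thetaQ F) ^ qc F)⁻¹ * ((DD F * Ulim (xs F 0) [qc F - 1]) * 1⁻¹))) := by
    have hi : Tendsto (fun d => (uu F d)⁻¹) atTop (𝓝 1⁻¹) := by
      rw [inv_one]
      apply tendsto_of_dle; intro b
      have : (uu F b)⁻¹ - 1 = (uu F b)⁻¹ * (-(uu F b - 1)) := by
        have := inv_mul_cancel₀ (uu_ne F b); linear_combination this
      rw [this]
      have h := dle_mul (n := 0) (le_of_eq ?_ : dle (uu F b)⁻¹ 0) (dle_neg (uu_dle F b))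
      · exact dle_mono h (by omega)
      · rw [map_inv₀, uu_v, inv_one, WithZero.exp_zero]
    have := ((t1.const_mul (DD F)).mul hi).const_mul (((-thetaQ F) ^ qc F)⁻¹)
    refine this.congr fun b => ?_
    rw [DU_eq, mul_assoc _ (uu F b), mul_inv_cancel₀ (uu_ne F b), mul_one, inv_mul_cancel_left₀ hth]
  have := (hasProd_gg F t2).tprod_eq
  rw [piQ]
  change (-thetaQ F) ^ qc F * ∏' i, gg F i = _
  rw [this, mul_inv_cancel_left₀ hth, inv_one, mul_one]
end exist1

section evsec
open Polynomial
variable (F : Type) [Field F]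

/-- evaluation at `θ`. -/
def ev : F[X] →+* KinfQ F := eval₂RingHom HahnSeries.C (thetaQ F)

lemma ev_X : ev F X = thetaQ F := by simp [ev]
lemma ev_C (a : F) : ev F (C a) = HahnSeries.C a := by simp [ev]

lemma theta_pow (n : ℕ) : thetaQ F ^ n = HahnSeries.single (-(n:ℤ)) 1 := by
  rw [thetaQ, HahnSeries.single_pow]; simp

lemma ev_coeff (p : F[X]) (m : ℤ) : (ev F p).coeff m = if m ≤ 0 then p.coeff (-m).toNat else 0 := by
  induction p using Polynomial.induction_on' with
  | add p q hp hq => rw [map_add, HahnSeries.coeff_add, hp, hq, coeff_add]; split_ifs <;> simp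
  | monomial n a =>
    rw [← C_mul_X_pow_eq_monomial, map_mul, map_pow, ev_X, ev_C, theta_pow, HahnSeries.C_mul_eq_smul,
      HahnSeries.coeff_smul, coeff_C_mul_X_pow, HahnSeries.coeff_single]
    by_cases h : m = -(n:ℤ)
    · simp [h]
    · rw [if_neg h, smul_zero]
      split_ifs with h1 h2
      · omega
      · rfl
      · rfl

lemma coeff_ev (p : F[X]) (n : ℕ) : (ev F p).coeff (-(n:ℤ)) = p.coeff n := by
  rw [ev_coeff, if_pos (by omega)]; simp

lemma ev_inj : Function.Injective (ev F) := by
  intro p q h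
  ext n
  rw [← coeff_ev, h, coeff_ev]

lemma ev_dle {p : F[X]} {n : ℤ} : dle (ev F p) n ↔ ∀ m : ℕ, n < m → p.coeff m = 0 := by
  rw [dle_iff]
  constructor
  · intro h m hm
    rw [← coeff_ev]; exact h _ (by omega)
  · intro h m hm
    rw [ev_coeff]
    split_ifs with h0
    · exact h _ (by omega)
    · rfl

lemma ev_K (p : F[X]) : ev F p ∈ Ksub F := by
  have h1 : ∀ b : F, (HahnSeries.C b : KinfQ F) ∈ Ksub F := fun b =>
    Subfield.subset_closure (Or.inl ⟨b, rfl⟩)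
  have h2 : thetaQ F ∈ Ksub F := Subfield.subset_closure (Or.inr rfl)
  rw [ev, coe_eval₂RingHom, eval₂_eq_sum_range]
  exact sum_mem fun i _ => mul_mem (h1 _) (pow_mem h2 _)
end evsec

/-- positivity of lists. -/
def Pos (s : List ℕ) : Prop := ∀ k ∈ s, 0 < k
lemma Pos_nil : Pos [] := by simp [Pos]
lemma Pos_cons {k : ℕ} {s : List ℕ} : Pos (k :: s) ↔ 0 < k ∧ Pos s := by simp [Pos]
lemma Pos_append {s t : List ℕ} : Pos (s ++ t) ↔ Pos s ∧ Pos t := by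
  simp [Pos, or_imp, forall_and]

section exist2
open Filter Topology
variable (A : Type) {L : Type} [CommRing A] [CommRing L] [Algebra A L]

/-- span of the truncated sums. -/
def VV (x : ℕ → L) (w : ℕ) : Submodule A (ℕ → L) :=
  Submodule.span A {f | ∃ s, Pos s ∧ s.sum = w ∧ f = U x s}

/-- span of the limits. -/
def MM (Z : List ℕ → L) (w : ℕ) : Submodule A L :=
  Submodule.span A {f | ∃ s, Pos s ∧ s.sum = w ∧ f = Z s}

lemma U_mem (x : ℕ → L) {s : List ℕ} (h : Pos s) : U x s ∈ VV A x s.sum :=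
  Submodule.subset_span ⟨s, h, rfl, rfl⟩

/-- summation operator. -/
def Op (x : ℕ → L) (k : ℕ) : (ℕ → L) →ₗ[A] (ℕ → L) where
  toFun f b := ∑ d ∈ Finset.range b, x d ^ k * f d
  map_add' f g := by
    ext1 b; simp [mul_add, Finset.sum_add_distrib]
  map_smul' a f := by
    ext1 b; simp [Finset.smul_sum]

lemma Op_apply (x : ℕ → L) (k : ℕ) (f : ℕ → L) (b : ℕ) :
    Op A x k f b = ∑ d ∈ Finset.range b, x d ^ k * f d := rfl
lemma Op_succ (x : ℕ → L) (k : ℕ) (f : ℕ → L) (b : ℕ) :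
    Op A x k f (b+1) = Op A x k f b + x b ^ k * f b := by rw [Op_apply, Op_apply, Finset.sum_range_succ]
lemma Op_zero (x : ℕ → L) (k : ℕ) (f : ℕ → L) :
    Op A x k f 0 = 0 := by simp [Op_apply]

lemma Op_U (x : ℕ → L) (k : ℕ) (s : List ℕ) : Op A x k (U x s) = U x (k :: s) := by
  ext1 b; rw [Op_apply, U_cons]

variable {A}
lemma Op_mem {x : ℕ → L} {k w : ℕ} (hk : 0 < k) {f : ℕ → L} (hf : f ∈ VV A x w) :
    Op A x k f ∈ VV A x (k + w) := by
  have : VV A x w ≤ (VV A x (k + w)).comap (Op A x k) := by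
    refine Submodule.span_le.2 ?_
    rintro _ ⟨s, hs, rfl, rfl⟩
    change Op A x k (U x s) ∈ VV A x (k + s.sum)
    rw [Op_U]
    exact Submodule.subset_span ⟨k :: s, Pos_cons.2 ⟨hk, hs⟩, by simp, rfl⟩
  exact this hf

variable (A)
lemma U_mul (x : ℕ → L) (j k : ℕ) (s t : List ℕ) :
    U x (j :: s) * U x (k :: t) = Op A x j (U x s * U x (k :: t)) + Op A x k (U x (j :: s) * U x t)
      + Op A x (j + k) (U x s * U x t) := by
  ext1 b
  induction b with
  | zero => simp [Op_zero, U_cons_zero]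
  | succ b ih =>
    simp only [Pi.add_apply, Pi.mul_apply, Op_succ, U_cons_succ] at ih ⊢
    rw [pow_add]
    linear_combination ih

lemma U_nil' (x : ℕ → L) : U x [] = 1 := by ext1 b; simp [U_nil]

lemma U_mul_mem (x : ℕ → L) {s t : List ℕ} (hs : Pos s) (ht : Pos t) :
    U x s * U x t ∈ VV A x (s.sum + t.sum) := by
  induction s generalizing t with
  | nil =>
    rw [U_nil', one_mul]; simpa using U_mem A x ht
  | cons j s ih =>
    induction t with
    | nil =>
      rw [U_nil', mul_one]; simpa using U_mem A x hs
    | cons k t ih2 =>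
      rw [U_mul A]
      obtain ⟨hj, hs'⟩ := Pos_cons.1 hs
      obtain ⟨hk, ht'⟩ := Pos_cons.1 ht
      refine add_mem (add_mem ?_ ?_) ?_
      · convert Op_mem hj (ih hs' ht) using 2; simp; ring
      · convert Op_mem hk (ih2 ht') using 2; simp; ring
      · convert Op_mem (by omega : 0 < j + k) (ih hs' ht') using 2; simp; ring

variable {A}
lemma VV_mul {x : ℕ → L} {w w' : ℕ} {f g : ℕ → L} (hf : f ∈ VV A x w) (hg : g ∈ VV A x w') :
    f * g ∈ VV A x (w + w') := by
  have : VV A x w * VV A x w' ≤ VV A x (w + w') := by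
    rw [VV, VV, Submodule.span_mul_span]
    refine Submodule.span_le.2 ?_
    rintro _ ⟨_, ⟨s, hs, rfl, rfl⟩, _, ⟨t, ht, rfl, rfl⟩, rfl⟩
    exact U_mul_mem A x hs ht
  exact this (Submodule.mul_mem_mul hf hg)

lemma VV_pow {x : ℕ → L} {w : ℕ} {f : ℕ → L} (hf : f ∈ VV A x w) (k : ℕ) :
    f ^ k ∈ VV A x (k * w) := by
  induction k with
  | zero =>
    rw [pow_zero, zero_mul, ← U_nil' x]
    exact Submodule.subset_span ⟨[], Pos_nil, rfl, rfl⟩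
  | succ k ih =>
    have h := VV_mul ih hf
    rw [← pow_succ] at h
    rw [add_mul, one_mul]
    exact h

variable [TopologicalSpace L] [IsTopologicalRing L] {x : ℕ → L} {Z : List ℕ → L}

lemma smul_tendsto' {f : ℕ → L} {y : L} (a : A) (h : Tendsto f atTop (𝓝 y)) :
    Tendsto (a • f) atTop (𝓝 (a • y)) := by
  have := h.const_mul (algebraMap A L a)
  rw [Algebra.smul_def a y]
  refine this.congr fun b => ?_
  simp [Algebra.smul_def]

lemma VV_lim (hZ : ∀ s, Pos s → Tendsto (U x s) atTop (𝓝 (Z s))) {w : ℕ} {f : ℕ → L} (hf : f ∈ VV A x w) :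
    ∃ y ∈ MM A Z w, Tendsto f atTop (𝓝 y) := by
  induction hf using Submodule.span_induction with
  | mem f h =>
    obtain ⟨s, hs, rfl, rfl⟩ := h
    exact ⟨_, Submodule.subset_span ⟨s, hs, rfl, rfl⟩, hZ s hs⟩
  | zero => exact ⟨0, zero_mem _, tendsto_const_nhds⟩
  | add f g _ _ hf hg =>
    obtain ⟨y, hy, ty⟩ := hf
    obtain ⟨z, hz, tz⟩ := hg
    exact ⟨y + z, add_mem hy hz, ty.add tz⟩
  | smul a f _ hf =>
    obtain ⟨y, hy, ty⟩ := hf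
    exact ⟨a • y, Submodule.smul_mem _ a hy, smul_tendsto' a ty⟩

variable (A)
/-- iterated operator -/
def Ops (x : ℕ → L) (u : List ℕ) (f : ℕ → L) : ℕ → L := u.foldr (fun k g => Op A x k g) f

variable {A}
lemma Ops_mem {w : ℕ} (u : List ℕ) (hu : Pos u) {f : ℕ → L} (hf : f ∈ VV A x w) :
    Ops A x u f ∈ VV A x (u.sum + w) := by
  induction u with
  | nil => simpa [Ops] using hf
  | cons k u ih =>
    obtain ⟨hk, hu'⟩ := Pos_cons.1 hu
    have := Op_mem hk (ih hu')
    rw [List.sum_cons, add_assoc]; exact this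

variable (A)
lemma Ops_U (x : ℕ → L) (u s : List ℕ) : Ops A x u (U x s) = U x (u ++ s) := by
  induction u with
  | nil => rfl
  | cons k u ih => change Op A x k (Ops A x u (U x s)) = _; rw [ih, Op_U]; rfl

lemma Ops_add (x : ℕ → L) (u : List ℕ) (f g : ℕ → L) : Ops A x u (f + g) = Ops A x u f + Ops A x u g := by
  induction u with
  | nil => rfl
  | cons k u ih => change Op A x k (Ops A x u _) = Op A x k (Ops A x u _) + Op A x k (Ops A x u _); rw [ih, map_add]

lemma Ops_smul (x : ℕ → L) (u : List ℕ) (a : A) (f : ℕ → L) : Ops A x u (a • f) = a • Ops A x u f := by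
  induction u with
  | nil => rfl
  | cons k u ih => change Op A x k (Ops A x u _) = a • Op A x k (Ops A x u _); rw [ih, map_smul]

lemma Ops_append_singleton (x : ℕ → L) (u : List ℕ) (j : ℕ) (f : ℕ → L) :
    Ops A x (u ++ [j]) f = Ops A x u (Op A x j f) := by
  simp [Ops]

/-- `E(k,v)`. -/
def EE (x : ℕ → L) (q k : ℕ) (v : List ℕ) (b : ℕ) : L := ∑ d ∈ Finset.range b, x d ^ (k * q) * U x v (d+1)

lemma EE_eq (x : ℕ → L) (q k : ℕ) (hk : 0 < k) (v : List ℕ) (D : A)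
    (hxq : ∀ d, x d ^ q = algebraMap A L D * x (d+1) * U x [q-1] (d+1)) :
    EE x q k v = D ^ k • (Op A x k (U x [q-1] ^ k * U x v) + x ^ k * (U x [q-1] ^ k * U x v)) := by
  ext1 b
  have h0 : (U x [q-1] ^ k * U x v) 0 = 0 := by
    simp [U_cons_zero, hk.ne']
  have : EE x q k v b = ∑ d ∈ Finset.range b, (algebraMap A L D) ^ k * (x (d+1) ^ k * (U x [q-1] ^ k * U x v) (d+1)) := by
    refine Finset.sum_congr rfl fun d _ => ?_
    rw [mul_comm k, pow_mul, hxq, mul_pow, mul_pow]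
    simp only [Pi.mul_apply, Pi.pow_apply]; ring
  rw [this, ← Finset.mul_sum]
  have h2 := Finset.sum_range_succ' (fun d => x d ^ k * (U x [q-1] ^ k * U x v) d) b
  rw [h0, mul_zero, add_zero] at h2
  rw [← h2, ← Op_apply A, Op_succ]
  simp [Algebra.smul_def]

lemma EE_nil (x : ℕ → L) (q k : ℕ) : EE x q k [] = U x [k * q] := by
  ext1 b
  rw [EE, U_cons]; simp [U_nil]
lemma EE_cons (x : ℕ → L) (q k j : ℕ) (v : List ℕ) :
    EE x q k (j :: v) = U x ((k * q) :: j :: v) + U x ((k * q + j) :: v) := by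
  ext1 b
  rw [EE, Pi.add_apply, U_cons, U_cons, ← Finset.sum_add_distrib]
  refine Finset.sum_congr rfl fun d _ => ?_
  rw [U_cons_succ]; ring

variable {A}
lemma EE_lim (hZ : ∀ s, Pos s → Tendsto (U x s) atTop (𝓝 (Z s))) (hx0 : Tendsto x atTop (𝓝 0))
    {q : ℕ} (hq : 1 < q) {k : ℕ} (hk : 0 < k) {u v : List ℕ} (hu : Pos u) (hv : Pos v) (D : A)
    (hxq : ∀ d, x d ^ q = algebraMap A L D * x (d+1) * U x [q-1] (d+1)) :
    ∃ y ∈ MM A Z (u.sum + k * q + v.sum), Tendsto (Ops A x u (EE x q k v)) atTop (𝓝 (D • y)) := by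
  obtain ⟨k', rfl⟩ : ∃ k', k = k' + 1 := ⟨k - 1, by omega⟩
  set k := k' + 1
  obtain ⟨q', rfl⟩ : ∃ q', q = q' + 2 := ⟨q - 2, by omega⟩
  set q := q' + 2
  rw [EE_eq A x q k hk v D hxq]
  set Y := U x [q-1] ^ k * U x v with hY
  have hYm : Y ∈ VV A x (k * (q-1) + v.sum) := by
    refine VV_mul ?_ (U_mem A x hv)
    have := VV_pow (U_mem A x (s := [q-1]) (pos_single (by omega))) k
    simpa using this
  have hkq : k * q = k + k * (q-1) := by
    rw [show q - 1 = q' + 1 from rfl, show q = q' + 1 + 1 from rfl]; ring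
  rcases List.eq_nil_or_concat u with rfl | ⟨u', j, rfl⟩
  · obtain ⟨y, hy, ty⟩ := VV_lim hZ (Op_mem hk hYm)
    obtain ⟨z, hz, tz⟩ := VV_lim hZ hYm
    refine ⟨D ^ k' • y, Submodule.smul_mem _ _ ?_, ?_⟩
    · convert hy using 2; simp [hkq]; ring
    · rw [smul_smul, ← pow_succ']
      change Tendsto (D ^ k • (Op A x k Y + x ^ k * Y)) atTop (𝓝 (D ^ k • y))
      refine smul_tendsto' _ ?_
      have := ty.add ((hx0.pow k).mul tz)
      simp only [k, ne_eq, Nat.add_eq_zero_iff, one_ne_zero, and_false, not_false_eq_true, zero_pow, zero_mul, add_zero] at this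
      exact this
  · rw [List.concat_eq_append] at hu ⊢
    obtain ⟨hu', hj⟩ := Pos_append.1 hu
    have hj : 0 < j := hj j (by simp)
    have e : Op A x j (D ^ k • (Op A x k Y + x ^ k * Y)) = D ^ k • (Op A x j (Op A x k Y) + Op A x (j + k) Y) := by
      rw [map_smul, map_add]
      congr 2
      ext1 b
      rw [Op_apply, Op_apply]
      refine Finset.sum_congr rfl fun d _ => ?_
      simp [pow_add, mul_assoc]
    rw [Ops_append_singleton, e, Ops_smul]
    have hm : Op A x j (Op A x k Y) + Op A x (j + k) Y ∈ VV A x (j + (k + (k * (q-1) + v.sum))) := by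
      refine add_mem (Op_mem hj (Op_mem hk hYm)) ?_
      rw [← add_assoc]; exact Op_mem (by omega) hYm
    obtain ⟨y, hy, ty⟩ := VV_lim hZ (Ops_mem u' hu' hm)
    refine ⟨D ^ k' • y, Submodule.smul_mem _ _ ?_, ?_⟩
    · convert hy using 2; simp [hkq]; ring
    · rw [smul_smul, ← pow_succ']
      exact smul_tendsto' _ ty

/-- span of the good limits. -/
def NN (A : Type) [CommRing A] [Algebra A L] (Z : List ℕ → L) (q w : ℕ) : Submodule A L :=
  Submodule.span A {f | ∃ s, Pos s ∧ s.sum = w ∧ (∀ k ∈ s, ¬ q ∣ k) ∧ f = Z s}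

lemma Z_mem [T2Space L] (hZ : ∀ s, Pos s → Tendsto (U x s) atTop (𝓝 (Z s))) (hx0 : Tendsto x atTop (𝓝 0))
    {q : ℕ} (hq : 1 < q) (D : A)
    (hxq : ∀ d, x d ^ q = algebraMap A L D * x (d+1) * U x [q-1] (d+1)) (w : ℕ) (n : ℕ) :
    ∀ s, s.length ≤ n → Pos s → s.sum = w → Z s ∈ NN A Z q w ⊔ Ideal.span {D} • MM A Z w := by
  induction n with
  | zero =>
    intro s hs hp hw
    rw [Nat.le_zero, List.length_eq_zero_iff] at hs
    subst hs
    exact Submodule.mem_sup_left (Submodule.subset_span ⟨[], hp, hw, by simp, rfl⟩)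
  | succ n ih =>
    intro s hs hp hw
    by_cases hg : ∀ k ∈ s, ¬ q ∣ k
    · exact Submodule.mem_sup_left (Submodule.subset_span ⟨s, hp, hw, hg, rfl⟩)
    push Not at hg
    obtain ⟨m, hm, k, rfl⟩ := hg
    obtain ⟨u, v, rfl⟩ := List.append_of_mem hm
    obtain ⟨hu, hv⟩ := Pos_append.1 hp
    obtain ⟨hk, hv⟩ := Pos_cons.1 hv
    rw [mul_comm q k] at *
    have hk : 0 < k := Nat.pos_of_mul_pos_right hk
    obtain ⟨y, hy, ty⟩ := EE_lim hZ hx0 hq hk hu hv D hxq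
    have hwe : u.sum + k * q + v.sum = w := by simp at hw; omega
    rw [hwe] at hy
    have hDy : D • y ∈ NN A Z q w ⊔ Ideal.span {D} • MM A Z w :=
      Submodule.mem_sup_right (Submodule.smul_mem_smul (Ideal.subset_span rfl) hy)
    cases v with
    | nil =>
      rw [EE_nil, Ops_U] at ty
      have := tendsto_nhds_unique ty (hZ _ hp)
      rw [← this]; exact hDy
    | cons j v =>
      rw [EE_cons, Ops_add, Ops_U, Ops_U] at ty
      obtain ⟨hj, hv⟩ := Pos_cons.1 hv
      have hp2 : Pos (u ++ (k * q + j) :: v) := Pos_append.2 ⟨hu, Pos_cons.2 ⟨by omega, hv⟩⟩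
      have := tendsto_nhds_unique ty ((hZ _ hp).add (hZ _ hp2))
      rw [eq_sub_of_add_eq this.symm]
      refine sub_mem hDy (ih _ ?_ hp2 ?_)
      · simp at hs ⊢; omega
      · simp at hw ⊢; omega

lemma MM_fg (Z : List ℕ → L) (w : ℕ) : (MM A Z w).FG := by
  refine Submodule.fg_span ?_
  refine (Set.finite_range (fun c : Composition w => Z c.blocks)).subset ?_
  rintro _ ⟨s, hs, hw, rfl⟩
  exact ⟨⟨s, fun {i} hi => hs i hi, hw⟩, rfl⟩

lemma nakayama [T2Space L] (hZ : ∀ s, Pos s → Tendsto (U x s) atTop (𝓝 (Z s))) (hx0 : Tendsto x atTop (𝓝 0))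
    {q : ℕ} (hq : 1 < q) (D : A)
    (hxq : ∀ d, x d ^ q = algebraMap A L D * x (d+1) * U x [q-1] (d+1)) (w : ℕ) :
    ∃ r : A, r - 1 ∈ Ideal.span {D} ∧ ∀ y ∈ MM A Z w, r • y ∈ NN A Z q w := by
  have hle : MM A Z w ≤ NN A Z q w ⊔ Ideal.span {D} • MM A Z w := by
    refine Submodule.span_le.2 ?_
    rintro _ ⟨s, hs, hw, rfl⟩
    exact Z_mem hZ hx0 hq D hxq w s.length s le_rfl hs hw
  obtain ⟨r, hr, h⟩ := Submodule.exists_sub_one_mem_and_smul_le_of_fg_of_le_sup (MM_fg (A := A) Z w) le_rfl hle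
  exact ⟨r, hr, fun y hy => h (Submodule.smul_mem_pointwise_smul _ _ _ hy)⟩
end exist2

section exist3
open Filter Topology
variable (F : Type) [Field F] [Fintype F]

/-- copy of `F[X]` acting through `θ`. -/
def PA : Type := Polynomial F
instance : CommRing (PA F) := inferInstanceAs (CommRing (Polynomial F))
instance : Algebra (PA F) (KinfQ F) := (ev F).toAlgebra

lemma algMap_PA (p : PA F) : algebraMap (PA F) (KinfQ F) p = ev F p := rfl

variable {F}
lemma STup_pos {Q w : ℕ} (t : STup Q w) : Pos (List.ofFn t.1.2) := by
  intro k hk; rw [List.mem_ofFn'] at hk; obtain ⟨i, rfl⟩ := hk; exact t.2.2.1 i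
lemma STup_sum {Q w : ℕ} (t : STup Q w) : (List.ofFn t.1.2).sum = w := by
  rw [List.sum_ofFn]; exact t.2.2.2.1
lemma STup_good {Q w : ℕ} (t : STup Q w) : ∀ k ∈ List.ofFn t.1.2, ¬ Q ∣ k := by
  intro k hk; rw [List.mem_ofFn'] at hk; obtain ⟨i, rfl⟩ := hk; exact t.2.2.2.2 i
lemma STup_inj {Q w : ℕ} : Function.Injective (fun t : STup Q w => List.ofFn t.1.2) := by
  intro t t' h
  apply Subtype.ext
  exact List.equivSigmaTuple.symm.injective h
lemma STup_surj {Q w : ℕ} (hw : 0 < w) {s : List ℕ} (h1 : Pos s) (h2 : s.sum = w) (h3 : ∀ k ∈ s, ¬ Q ∣ k) :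
    ∃ t : STup Q w, List.ofFn t.1.2 = s := by
  have hs : s ≠ [] := by rintro rfl; simp at h2; omega
  refine ⟨⟨⟨s.length, s.get⟩, List.length_pos_iff.2 hs, fun i => h1 _ (List.get_mem _ _), ?_,
    fun i => h3 _ (List.get_mem _ _)⟩, List.ofFn_get s⟩
  rw [← List.sum_ofFn, List.ofFn_get, h2]

instance STup_finite {Q w : ℕ} : Finite (STup Q w) := by
  refine Finite.of_injective (β := Composition w)
    (fun t => ⟨List.ofFn t.1.2, fun {i} hi => STup_pos t i hi, STup_sum t⟩) ?_
  intro t t' h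
  exact STup_inj (congrArg Composition.blocks h)

lemma LiQ_STup {w : ℕ} (t : STup (qc F) w) : LiQ F t.1.1 t.1.2 = Ulim (xs F 0) (List.ofFn t.1.2) :=
  LiQ_eq F _ _ t.2.2.1

lemma xs_tendsto : Tendsto (xs F 0) atTop (𝓝 0) := by
  apply tendsto_of_dle; intro b; rw [sub_zero]; exact xs_dle F 0 b

theorem existence (w : ℕ) (hw : 0 < w) (hdvd : (qc F - 1) ∣ w) :
    ∃ a : STup (qc F) w → KinfQ F,
      (∀ t, a t ∈ Ksub F) ∧
      piQ F ^ (w / (qc F - 1)) + ∑' t : STup (qc F) w, a t * LiQ F t.1.1 t.1.2 = 0 := by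
  have hq := one_lt_qc (F := F)
  obtain ⟨k, rfl⟩ := hdvd
  rw [Nat.mul_div_cancel_left _ (by omega)]
  set w := (qc F - 1) * k with hwdef
  have hZ : ∀ s, Pos s → Tendsto (U (xs F 0) s) atTop (𝓝 (Ulim (xs F 0) s)) :=
    fun s hs => Ulim_tendsto (xs_dle F 0) hs
  let D : PA F := (Polynomial.X - Polynomial.X ^ qc F : Polynomial F)
  have hD : algebraMap (PA F) (KinfQ F) D = DD F := by
    rw [algMap_PA, DD]
    change ev F (Polynomial.X - Polynomial.X ^ qc F) = _
    rw [map_sub, map_pow, ev_X]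
  obtain ⟨r, hr, h⟩ := nakayama (A := PA F) hZ xs_tendsto hq D (by rw [hD]; exact x_pow_q F) w
  have hr0 : ev F r ≠ 0 := by
    intro h0
    have : r = 0 := ev_inj F (by rw [h0]; exact (map_zero (ev F)).symm)
    rw [this, zero_sub, Ideal.mem_span_singleton] at hr
    obtain ⟨c, hc⟩ := hr
    have key : ∀ c : Polynomial F, (-1 : Polynomial F) ≠ (Polynomial.X - Polynomial.X ^ qc F) * c := by
      intro c h2
      have h3 := congrArg (Polynomial.eval 0) h2
      simp [show qc F ≠ 0 by omega] at h3
    exact key c hc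
  have hpi : piQ F ^ k ∈ MM (PA F) (Ulim (xs F 0)) w := by
    have hp : Pos [qc F - 1] := pos_single (by omega)
    have h1 := VV_pow (U_mem (PA F) (xs F 0) hp) k
    rw [List.sum_singleton, mul_comm, ← hwdef] at h1
    obtain ⟨y, hy, ty⟩ := VV_lim hZ h1
    have h2 : Ulim (xs F 0) [qc F - 1] ^ k = y := tendsto_nhds_unique ((hZ _ hp).pow k) ty
    rw [piQ_eq, mul_pow, h2, ← hD, ← map_pow, ← Algebra.smul_def]
    exact Submodule.smul_mem _ _ hy
  have hN := h _ hpi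
  have hNN : NN (PA F) (Ulim (xs F 0)) (qc F) w
      ≤ Submodule.span (PA F) (Set.range fun t : STup (qc F) w => LiQ F t.1.1 t.1.2) := by
    refine Submodule.span_mono ?_
    rintro _ ⟨s, h1, h2, h3, rfl⟩
    obtain ⟨t, rfl⟩ := STup_surj hw h1 h2 h3
    exact ⟨t, LiQ_STup t⟩
  have := Fintype.ofFinite (STup (qc F) w)
  obtain ⟨c, hc⟩ := (Submodule.mem_span_range_iff_exists_fun _).1 (hNN hN)
  refine ⟨fun t => - (ev F (c t) / ev F r), fun t => neg_mem (div_mem (ev_K F _) (ev_K F _)), ?_⟩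
  rw [tsum_fintype]
  have hc' : ∑ t, ev F (c t) * LiQ F t.1.1 t.1.2 = ev F r * piQ F ^ k := hc
  have : ∑ t : STup (qc F) w, -(ev F (c t) / ev F r) * LiQ F t.1.1 t.1.2 = - (ev F r)⁻¹ * ∑ t, ev F (c t) * LiQ F t.1.1 t.1.2 := by
    rw [Finset.mul_sum]
    refine Finset.sum_congr rfl fun t _ => ?_
    rw [div_eq_mul_inv]; ring
  rw [this, hc', neg_mul, inv_mul_cancel_left₀ hr0, add_neg_cancel]
end exist3

section GIsec
/-- good lists of weight at most `W`. -/
def GI (q W : ℕ) : Type := {s : List ℕ // Pos s ∧ (∀ k ∈ s, ¬ q ∣ k) ∧ s.sum ≤ W}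

instance GI_finite (q W : ℕ) : Finite (GI q W) := by
  refine Finite.of_injective (β := Σ w : Fin (W+1), Composition w)
    (fun t => ⟨⟨t.1.sum, by have := t.2.2.2; omega⟩, ⟨t.1, fun {i} hi => t.2.1 i hi, rfl⟩⟩) ?_
  intro t t' h
  apply Subtype.ext
  simp only [Sigma.mk.injEq, Fin.mk.injEq] at h
  obtain ⟨h1, h2⟩ := h
  have key : ∀ (a b : Σ w : Fin (W+1), Composition w), a = b → a.2.blocks = b.2.blocks := by
    rintro a b rfl; rfl
  exact key ⟨⟨t.1.sum, by have := t.2.2.2; omega⟩, ⟨t.1, fun {i} hi => t.2.1 i hi, rfl⟩⟩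
    ⟨⟨t'.1.sum, by have := t'.2.2.2; omega⟩, ⟨t'.1, fun {i} hi => t'.2.1 i hi, rfl⟩⟩
    (Sigma.ext (Fin.ext h1) h2)

instance GI_fintype (q W : ℕ) : Fintype (GI q W) := Fintype.ofFinite _

variable {q W : ℕ}

/-- tail. -/
def tl (s : GI q W) : GI q W := ⟨s.1.tail, fun k hk => s.2.1 k (List.mem_of_mem_tail hk),
  fun k hk => s.2.2.1 k (List.mem_of_mem_tail hk), by
    have h := s.2.2.2
    rcases s with ⟨_ | ⟨k, s⟩, hs⟩
    · exact h
    · simp at h ⊢; omega⟩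

/-- the transport operator -/
def PP {R : Type*} [AddCommMonoid R] (c : GI q W → R) (s : GI q W) : R :=
  c s + ∑ t : GI q W, if t.1 ≠ [] ∧ tl t = s then c t else 0

lemma PP_sum {R : Type*} [CommRing R] (c B : GI q W → R) :
    ∑ s, c s * (B s + if s.1 = [] then 0 else B (tl s)) = ∑ s, PP c s * B s := by
  simp only [PP, mul_add, add_mul, Finset.sum_add_distrib]
  congr 1
  simp only [Finset.sum_mul]
  rw [Finset.sum_comm]
  refine Finset.sum_congr rfl fun t _ => ?_
  by_cases h : t.1 = []
  · simp [h]
  · simp [h, ite_mul]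

lemma PP_map {R S : Type*} [CommRing R] [CommRing S] (f : R →+* S) (c : GI q W → R) (s : GI q W) :
    f (PP c s) = PP (fun t => f (c t)) s := by
  simp only [PP, map_add, map_sum]
  congr 1
  refine Finset.sum_congr rfl fun t _ => ?_
  split_ifs <;> simp

lemma PP_lead {R : Type*} [AddCommMonoid R] {c : GI q W → R} {n : ℕ}
    (h : ∀ s, n < s.1.length → c s = 0) {s : GI q W} (hs : n ≤ s.1.length) : PP c s = c s := by
  rw [PP, Finset.sum_eq_zero, add_zero]
  intro t _
  split_ifs with ht
  · refine h t ?_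
    have := congrArg (fun z : GI q W => z.1.length) ht.2
    simp only [tl, List.length_tail] at this
    have := List.length_pos_iff.2 ht.1
    omega
  · rfl

lemma PP_zero {R : Type*} [AddCommMonoid R] {c : GI q W → R} {n : ℕ}
    (h : ∀ s : GI q W, n ≤ s.1.length → PP c s = 0) : ∀ s : GI q W, n ≤ s.1.length → c s = 0 := by
  by_contra hcon
  push Not at hcon
  obtain ⟨s0, hs0, hc0⟩ := hcon
  obtain ⟨s, hs, hmax⟩ := Finset.exists_max_image (Finset.univ.filter fun s : GI q W => n ≤ s.1.length ∧ c s ≠ 0)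
    (fun s => s.1.length) ⟨s0, by simp [hs0, hc0]⟩
  simp only [Finset.mem_filter, Finset.mem_univ, true_and] at hs hmax
  have := PP_lead (c := c) (n := s.1.length) (fun t ht => by
    by_contra hne
    have := hmax t ⟨by omega, hne⟩
    omega) le_rfl
  rw [h s hs.1] at this
  exact hs.2 this.symm

lemma PP_ne_zero {R : Type*} [AddCommMonoid R] {c : GI q W → R} (h : c ≠ 0) : ∃ s, PP c s ≠ 0 := by
  by_contra hcon
  push Not at hcon
  exact h (funext fun s => PP_zero (n := 0) (fun s _ => hcon s) s (Nat.zero_le _))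

/-- linear version of `m^w P`. -/
def PL {K0 : Type*} [CommRing K0] (m : K0) (q W : ℕ) : (GI q W → K0) →ₗ[K0] (GI q W → K0) where
  toFun c s := m ^ s.1.sum * PP c s
  map_add' c d := by
    ext1 s
    simp only [PP, Pi.add_apply, ← mul_add]
    congr 1
    have : ∀ t : GI q W, (if t.1 ≠ [] ∧ tl t = s then c t + d t else 0) =
      (if t.1 ≠ [] ∧ tl t = s then c t else 0) + (if t.1 ≠ [] ∧ tl t = s then d t else 0) := by
      intro t; split_ifs <;> simp
    simp only [this, Finset.sum_add_distrib]
    abel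
  map_smul' a c := by
    ext1 s
    simp only [PP, Pi.smul_apply, smul_eq_mul, RingHom.id_apply, mul_add, Finset.mul_sum, mul_ite, mul_zero]
    congr 1
    · ring
    · refine Finset.sum_congr rfl fun t _ => ?_
      split_ifs
      · ring
      · rfl

lemma PL_apply {K0 : Type*} [CommRing K0] (m : K0) (q W : ℕ) (c : GI q W → K0) (s : GI q W) :
    PL m q W c s = m ^ s.1.sum * PP c s := rfl

lemma PL_surj {K0 : Type*} [Field K0] {m : K0} (hm : m ≠ 0) (q W : ℕ) : Function.Surjective (PL m q W) := by
  rw [← LinearMap.injective_iff_surjective, ← LinearMap.ker_eq_bot, LinearMap.ker_eq_bot']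
  intro c hc
  by_contra hne
  obtain ⟨s, hs⟩ := PP_ne_zero hne
  have := congrFun hc s
  rw [PL_apply, Pi.zero_apply, mul_eq_zero] at this
  rcases this with h | h
  · exact pow_ne_zero _ hm h
  · exact hs h
end GIsec

section INDsec
variable {q W : ℕ}

/-- functional equation -/
def FE {K0 L : Type*} [CommRing K0] [CommRing L] (ι : K0 →+* L) (m : K0) (q : ℕ) (g : List ℕ → L) : Prop :=
  g [] = 1 ∧ ∀ k s, Pos (k :: s) → g (k :: s) = ι m ^ (s.sum + k) * g (k :: s) ^ q + ι m ^ s.sum * g s ^ q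

lemma FE_sum {K0 L : Type*} [CommRing K0] [CommRing L] {ι : K0 →+* L} {m : K0} {g : List ℕ → L} (h : FE ι m q g) (c : GI q W → K0) :
    ∑ s, ι (c s) * g s.1 = ∑ s, ι (PL m q W c s) * g s.1 ^ q := by
  have e : ∀ s : GI q W, g s.1 = (fun s : GI q W => ι m ^ s.1.sum * g s.1 ^ q) s +
      if s.1 = [] then 0 else (fun s : GI q W => ι m ^ s.1.sum * g s.1 ^ q) (tl s) := by
    rintro ⟨s, hs⟩
    cases s with
    | nil => simp [h.1]
    | cons k s => simp [tl]; rw [add_comm k s.sum]; exact h.2 k s hs.1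
  have e2 : ∑ s : GI q W, ι (c s) * g s.1 = ∑ s, ι (c s) * ((fun s : GI q W => ι m ^ s.1.sum * g s.1 ^ q) s +
      if s.1 = [] then 0 else (fun s : GI q W => ι m ^ s.1.sum * g s.1 ^ q) (tl s)) :=
    Finset.sum_congr rfl fun s _ => by rw [← e s]
  rw [e2, PP_sum]
  refine Finset.sum_congr rfl fun s _ => ?_
  rw [PL_apply, map_mul, map_pow, PP_map]
  ring

variable {K0 L : Type*} [Field K0] [Field L] {ι : K0 →+* L} {m : K0} {g : List ℕ → L}
lemma IND_key (h : FE ι m q g) (hm : m ≠ 0)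
    (hadd : ∀ a : GI q W → L, (∑ s, a s) ^ q = ∑ s, a s ^ q) (hq : q ≠ 0)
    (hV : ∃ c : GI q W → K0, c ≠ 0 ∧ ∑ s, ι (c s) * g s.1 = 0) :
    ∃ (c : GI q W → K0) (s0 : GI q W), c s0 = 1 ∧ (∀ s, s0.1.length < s.1.length → c s = 0) ∧
      ∑ s, ι (c s) * g s.1 = 0 ∧ ∀ s, m ^ s.1.sum * PP c s = m ^ s0.1.sum * c s ^ q := by
  -- minimal depth
  have hex : ∃ n : ℕ, ∃ c : GI q W → K0, c ≠ 0 ∧ ∑ s, ι (c s) * g s.1 = 0 ∧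
      ∀ s : GI q W, n < s.1.length → c s = 0 := by
    obtain ⟨c, hc, hr⟩ := hV
    refine ⟨W, c, hc, hr, fun s hs => ?_⟩
    exfalso
    have h1 := s.2.2.2
    have h2 : s.1.length ≤ s.1.sum := List.length_le_sum_of_one_le _ (fun i hi => s.2.1 i hi)
    omega
  set n := Nat.find hex with hn
  have hmin : ∀ c : GI q W → K0, ∑ s, ι (c s) * g s.1 = 0 →
      (∀ s : GI q W, n ≤ s.1.length → c s = 0) → c = 0 := by
    intro c hr hz
    by_contra hne
    rcases Nat.eq_zero_or_pos n with h0 | h0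
    · exact hne (funext fun s => hz s (by omega))
    · exact Nat.find_min hex (m := n - 1) (by omega) ⟨c, hne, hr, fun s hs => hz s (by omega)⟩
  have hex2 : ∃ N : ℕ, ∃ c : GI q W → K0, c ≠ 0 ∧ ∑ s, ι (c s) * g s.1 = 0 ∧
      (∀ s : GI q W, n < s.1.length → c s = 0) ∧
      (Finset.univ.filter fun s : GI q W => s.1.length = n ∧ c s ≠ 0).card = N := by
    obtain ⟨c, h1, h2, h3⟩ := Nat.find_spec hex
    exact ⟨_, c, h1, h2, h3, rfl⟩
  obtain ⟨c, hc, hr, hd, hcard⟩ := Nat.find_spec hex2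
  have hmin2 : ∀ d : GI q W → K0, ∑ s, ι (d s) * g s.1 = 0 → (∀ s : GI q W, n < s.1.length → d s = 0) →
      (∀ s : GI q W, s.1.length = n → c s = 0 → d s = 0) → (∃ s : GI q W, s.1.length = n ∧ c s ≠ 0 ∧ d s = 0) → d = 0 := by
    intro d h1 h2 h3 h4
    by_contra hne
    refine Nat.find_min hex2 (m := _) ?_ ⟨d, hne, h1, h2, rfl⟩
    rw [← hcard]
    apply Finset.card_lt_card
    rw [Finset.ssubset_iff_of_subset]
    · obtain ⟨s, a1, a2, a3⟩ := h4
      exact ⟨s, by simp [a1, a2], by simp [a3]⟩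
    · intro s
      simp only [Finset.mem_filter, Finset.mem_univ, true_and]
      rintro ⟨a1, a2⟩
      exact ⟨a1, fun a3 => a2 (h3 s a1 a3)⟩
  obtain ⟨s0, hs0, hcs0⟩ : ∃ s0 : GI q W, s0.1.length = n ∧ c s0 ≠ 0 := by
    by_contra hcon
    push Not at hcon
    refine hc (hmin c hr fun s hs => ?_)
    rcases hs.lt_or_eq with h1 | h1
    · exact hd s h1
    · exact hcon s h1.symm
  -- normalise
  set c' : GI q W → K0 := fun s => c s / c s0 with hc'
  have hr' : ∑ s, ι (c' s) * g s.1 = 0 := by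
    have : ∑ s, ι (c' s) * g s.1 = (ι (c s0))⁻¹ * ∑ s, ι (c s) * g s.1 := by
      rw [Finset.mul_sum]
      refine Finset.sum_congr rfl fun s _ => ?_
      rw [hc', map_div₀, div_eq_mul_inv]; ring
    rw [this, hr, mul_zero]
  have hd' : ∀ s : GI q W, n < s.1.length → c' s = 0 := fun s hs => by simp [hc', hd s hs]
  have h1' : c' s0 = 1 := div_self hcs0
  refine ⟨c', s0, h1', fun s hs => hd' s (by omega), hr', ?_⟩
  obtain ⟨e, he⟩ := PL_surj hm q W (fun s => m ^ s.1.sum * PP c' s - m ^ s0.1.sum * c' s ^ q)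
  have he' : ∀ s, m ^ s.1.sum * PP e s = m ^ s.1.sum * PP c' s - m ^ s0.1.sum * c' s ^ q :=
    fun s => congrFun he s
  have her : ∑ s, ι (e s) * g s.1 = 0 := by
    rw [FE_sum h, he]
    simp only [map_sub, sub_mul, Finset.sum_sub_distrib]
    have a1 := FE_sum h c'
    simp only [PL_apply] at a1
    rw [← a1, hr', zero_sub, neg_eq_zero]
    have a2 := hadd (fun s => ι (c' s) * g s.1)
    rw [hr', zero_pow hq] at a2
    have : ∑ s : GI q W, ι (m ^ s0.1.sum * c' s ^ q) * g s.1 ^ q = ι (m ^ s0.1.sum) * ∑ s, (ι (c' s) * g s.1) ^ q := by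
      rw [Finset.mul_sum]
      refine Finset.sum_congr rfl fun s _ => ?_
      rw [map_mul, map_pow ι (c' s), mul_pow]; ring
    rw [this, ← a2, mul_zero]
  have hed : ∀ s : GI q W, n < s.1.length → e s = 0 := by
    intro s hs
    refine PP_zero (n := n+1) (fun s hs => ?_) s hs
    have := he' s
    rw [PP_lead hd' (by omega), hd' s hs, zero_pow hq, mul_zero, mul_zero, sub_zero] at this
    exact (mul_eq_zero.1 this).resolve_left (pow_ne_zero _ hm)
  have hen : ∀ s : GI q W, s.1.length = n → m ^ s.1.sum * e s = m ^ s.1.sum * c' s - m ^ s0.1.sum * c' s ^ q := by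
    intro s hs
    have := he' s
    rwa [PP_lead hed (by omega), PP_lead hd' (by omega)] at this
  have e0 : e = 0 := by
    refine hmin2 e her hed (fun s hs hcs => ?_) ⟨s0, hs0, hcs0, ?_⟩
    · have := hen s hs
      rw [show c' s = 0 by simp [hc', hcs], zero_pow hq, mul_zero, mul_zero, sub_zero] at this
      exact (mul_eq_zero.1 this).resolve_left (pow_ne_zero _ hm)
    · have := hen s0 hs0
      rw [h1', one_pow, sub_self] at this
      exact (mul_eq_zero.1 this).resolve_left (pow_ne_zero _ hm)
  intro s
  have := he' s
  rw [show PP e s = 0 by simp [e0, PP], mul_zero] at this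
  exact sub_eq_zero.1 this.symm
end INDsec

section INDsec2
variable {q W : ℕ} {K0 L : Type*} [Field K0] [Field L] {ι : K0 →+* L} {m : K0} {g : List ℕ → L}

open WithZero in
lemma IND (v : Valuation K0 (WithZero (Multiplicative ℤ))) (hv : v m = WithZero.exp (1:ℤ)) (h : FE ι m q g)
    (hadd : ∀ a : GI q W → L, (∑ s, a s) ^ q = ∑ s, a s ^ q) (hq : 2 ≤ q)
    (c : GI q W → K0) (hc : ∑ s, ι (c s) * g s.1 = 0) : c = 0 := by
  by_contra hne
  have hm : m ≠ 0 := by rintro rfl; rw [map_zero] at hv; exact WithZero.exp_ne_zero hv.symm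
  obtain ⟨c, s0, h0, hd, hr, he⟩ := IND_key h hm hadd (by omega) ⟨c, hne, hc⟩
  have hvm : ∀ k : ℕ, v (m ^ k) = WithZero.exp (k:ℤ) := by
    intro k
    rw [map_pow, hv, ← WithZero.exp_nsmul]; simp
  have hs0 : s0.1 ≠ [] := by
    intro hnil
    rw [Finset.sum_eq_single s0] at hr
    · rw [h0, hnil, h.1] at hr; simp at hr
    · intro s _ hs
      rw [hd s, map_zero, zero_mul]
      rw [hnil]
      rcases s with ⟨_ | ⟨k, s⟩, hs'⟩
      · exact absurd (Subtype.ext hnil.symm) hs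
      · simp
    · simp
  set s1 := tl s0 with hs1
  -- children
  set T := Finset.univ.filter (fun t : GI q W => t.1 ≠ [] ∧ tl t = s1) with hT
  have hchild : ∀ t ∈ T, ∃ k : ℕ, 0 < k ∧ ¬ q ∣ k ∧ t.1 = k :: s1.1 := by
    intro t htT
    have h1 := (Finset.mem_filter.1 htT).2
    cases htl : t.1 with
    | nil => exact absurd htl h1.1
    | cons k s =>
      have := congrArg Subtype.val h1.2
      simp only [tl, htl, List.tail_cons] at this
      exact ⟨k, t.2.1 k (by simp [htl]), t.2.2.1 k (by simp [htl]), by rw [this]⟩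
  have hs0T : s0 ∈ T := by simp [hT, hs0, hs1]
  obtain ⟨m0, hm0, hqm0, hs0e⟩ := hchild s0 hs0T
  have hdeg : ∀ t ∈ T, c t ≠ 0 → ((q:ℤ) - 1) * WithZero.log (v (c t)) = (t.1.sum : ℤ) - s0.1.sum := by
    intro t ht hct
    obtain ⟨k, hk, hqk, hte⟩ := hchild t ht
    have e := he t
    rw [PP_lead hd (by rw [hte, hs0e]; simp)] at e
    have e2 := congrArg (fun z => WithZero.log (v z)) e
    simp only [map_mul, hvm, map_pow v (c t)] at e2
    have hvt : v (c t) ≠ 0 := (Valuation.ne_zero_iff v).2 hct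
    rw [WithZero.log_mul WithZero.exp_ne_zero hvt, WithZero.log_mul WithZero.exp_ne_zero (pow_ne_zero _ hvt),
      WithZero.log_exp, WithZero.log_exp, WithZero.log_pow] at e2
    simp only [nsmul_eq_mul] at e2
    linarith
  obtain ⟨t1, ht1, hmax⟩ := Finset.exists_max_image (T.filter fun t => c t ≠ 0) (fun t => t.1.sum)
    ⟨s0, by simp [hs0T, h0]⟩
  rw [Finset.mem_filter] at ht1
  obtain ⟨m1, hm1, hqm1, ht1e⟩ := hchild t1 ht1.1
  have hv1 : v (c t1) ≠ 0 := (Valuation.ne_zero_iff v).2 ht1.2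
  have hinj : ∀ t ∈ T, t.1.sum = t1.1.sum → t = t1 := by
    intro t ht hsum
    obtain ⟨k, hk, hqk, hte⟩ := hchild t ht
    apply Subtype.ext
    rw [hte, ht1e] at hsum ⊢
    simp at hsum
    rw [hsum]
  have hS : v (∑ t ∈ T, c t) = v (c t1) := by
    refine Valuation.map_sum_eq_of_lt v ht1.1 fun t ht => ?_
    rw [Finset.mem_sdiff, Finset.mem_singleton] at ht
    by_cases hct : c t = 0
    · rw [hct, map_zero]; exact zero_lt_iff.2 hv1
    · have hvt : v (c t) ≠ 0 := (Valuation.ne_zero_iff v).2 hct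
      rw [← WithZero.log_lt_log hvt hv1]
      have a1 := hdeg t ht.1 hct
      have a2 := hdeg t1 ht1.1 ht1.2
      have a3 := hmax t (by simp [ht.1, hct])
      have a4 : t.1.sum ≠ t1.1.sum := fun h => ht.2 (hinj t ht.1 h)
      have a5 : (t.1.sum : ℤ) < t1.1.sum := by exact_mod_cast lt_of_le_of_ne a3 a4
      have a6 : (0:ℤ) < (q:ℤ) - 1 := by omega
      refine lt_of_mul_lt_mul_left (a := (q:ℤ) - 1) ?_ a6.le
      linarith
  have hPP : PP c s1 = c s1 + ∑ t ∈ T, c t := by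
    rw [PP, hT, Finset.sum_filter]
  have e := he s1
  have hsum0 : s0.1.sum = s1.1.sum + m0 := by rw [hs0e]; simp [add_comm]
  have hsum1 : t1.1.sum = s1.1.sum + m1 := by rw [ht1e]; simp [add_comm]
  rw [hPP, hsum0, pow_add, mul_assoc] at e
  have e := mul_left_cancel₀ (pow_ne_zero _ hm) e
  have d1 := hdeg t1 ht1.1 ht1.2
  have d0 : (m0:ℤ) ≤ m1 := by
    have := hmax s0 (by simp [hs0T, h0])
    omega
  set ε := WithZero.log (v (c t1)) with hε
  have d2 : ((q:ℤ) - 1) * ε = m1 - m0 := by rw [d1]; push_cast [hsum0, hsum1]; ring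
  have hεv : v (c t1) = WithZero.exp ε := (WithZero.exp_log hv1).symm
  have hε0 : 0 ≤ ε := by
    by_contra hlt
    have : (0:ℤ) < (q:ℤ) - 1 := by omega
    nlinarith
  have hSe : ∑ t ∈ T, c t = m ^ m0 * c s1 ^ q - c s1 := by rw [← e]; ring
  have hc1 : c s1 ≠ 0 := by
    intro h1
    rw [h1, zero_pow (by omega), mul_zero, sub_zero] at hSe
    rw [hSe, map_zero] at hS
    exact hv1 hS.symm
  have hvc1 : v (c s1) ≠ 0 := (Valuation.ne_zero_iff v).2 hc1
  set δ := WithZero.log (v (c s1)) with hδ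
  have hδv : v (c s1) = WithZero.exp δ := (WithZero.exp_log hvc1).symm
  have hv2 : v (m ^ m0 * c s1 ^ q) = WithZero.exp ((m0:ℤ) + q * δ) := by
    rw [map_mul, hvm, map_pow, hδv, ← WithZero.exp_nsmul, ← WithZero.exp_add]; simp
  rw [hSe, hεv] at hS
  by_cases hlt : δ < (m0:ℤ) + q * δ
  · rw [Valuation.map_sub_eq_of_lt_left v (by rw [hv2, hδv]; exact WithZero.exp_lt_exp.2 hlt), hv2,
      WithZero.exp_inj] at hS
    apply hqm1
    have : (q:ℤ) ∣ m1 := ⟨ε - δ, by linarith⟩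
    exact_mod_cast this
  · have := Valuation.map_sub v (m ^ m0 * c s1 ^ q) (c s1)
    rw [hS, hv2, hδv, max_eq_right (WithZero.exp_le_exp.2 (not_lt.1 hlt)), WithZero.exp_le_exp] at this
    have : (2:ℤ) ≤ q := by exact_mod_cast hq
    have : (0:ℤ) < m0 := by exact_mod_cast hm0
    nlinarith
end INDsec2

section Formal
open PowerSeries
variable {R : Type*} [CommRing R]

/-- inverse of a series with constant coefficient one -/
def gi (f : R⟦X⟧) : R⟦X⟧ := PowerSeries.invOfUnit f 1

lemma gi_mul {f : R⟦X⟧} (h : constantCoeff f = 1) : f * gi f = 1 := by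
  rw [gi, PowerSeries.mul_invOfUnit]; simpa using h

lemma gi_unique {f g : R⟦X⟧} (h : constantCoeff f = 1) (hg : f * g = 1) : g = gi f := by
  calc g = g * (f * gi f) := by rw [gi_mul h, mul_one]
    _ = (f * g) * gi f := by ring
    _ = gi f := by rw [hg, one_mul]

lemma gi_map {S : Type*} [CommRing S] (φ : R →+* S) {f : R⟦X⟧} (h : constantCoeff f = 1) :
    PowerSeries.map φ (gi f) = gi (PowerSeries.map φ f) := by
  apply gi_unique
  · rw [← coeff_zero_eq_constantCoeff_apply, coeff_map, coeff_zero_eq_constantCoeff_apply, h, map_one]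
  · rw [← map_mul, gi_mul h, map_one]

lemma gi_const {f : R⟦X⟧} (h : constantCoeff f = 1) : constantCoeff (gi f) = 1 := by
  have := congrArg constantCoeff (gi_mul h)
  rwa [map_mul, h, one_mul, map_one] at this

lemma cc_one_sub (t : R) {k : ℕ} (hk : k ≠ 0) : constantCoeff (1 - C t * X ^ k : R⟦X⟧) = 1 := by
  simp [hk]

/-- formal version of `1/ℓ_d` -/
def MS (q : ℕ) (t : R) (d : ℕ) : R⟦X⟧ :=
  ∏ i ∈ Finset.range d, (-(X ^ (q ^ i)) * gi (1 - C t * X ^ (q ^ i)))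

variable {q : ℕ}

lemma MS_map {S : Type*} [CommRing S] (φ : R →+* S) (hq : q ≠ 0) (t : R) (d : ℕ) :
    PowerSeries.map φ (MS q t d) = MS q (φ t) d := by
  rw [MS, map_prod, MS]
  refine Finset.prod_congr rfl fun i _ => ?_
  rw [map_mul, gi_map _ (cc_one_sub t (pow_ne_zero _ hq))]
  simp

lemma X_dvd_MS (hq : q ≠ 0) (t : R) (d : ℕ) : (X : R⟦X⟧) ^ d ∣ MS q t d := by
  rw [MS]
  induction d with
  | zero => simp
  | succ d ih =>
    rw [Finset.prod_range_succ, pow_succ]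
    refine mul_dvd_mul ih (Dvd.dvd.mul_right ?_ _)
    rw [dvd_neg]
    exact dvd_pow_self _ (pow_ne_zero _ hq)

lemma X_dvd_U_succ {x : ℕ → R⟦X⟧} (hx : ∀ d, (X : R⟦X⟧) ^ d ∣ x d) {s : List ℕ} (hs : Pos s) (b : ℕ) :
    (X : R⟦X⟧) ^ b ∣ U x s (b+1) - U x s b := by
  cases s with
  | nil => simp [U_nil]
  | cons k s =>
    rw [U_cons_succ, add_sub_cancel_left]
    refine Dvd.dvd.mul_right ?_ _
    exact (hx b).trans (dvd_pow_self _ (hs k (by simp)).ne')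

lemma X_dvd_U {x : ℕ → R⟦X⟧} (hx : ∀ d, (X : R⟦X⟧) ^ d ∣ x d) {s : List ℕ} (hs : Pos s) {b c : ℕ} (h : b ≤ c) :
    (X : R⟦X⟧) ^ b ∣ U x s c - U x s b := by
  induction c, h using Nat.le_induction with
  | base => simp
  | succ c hc ih =>
    have := dvd_add ((pow_dvd_pow X hc).trans (X_dvd_U_succ hx hs c)) ih
    simpa using this

/-- formal limit -/
def LL (x : ℕ → R⟦X⟧) (s : List ℕ) : R⟦X⟧ := PowerSeries.mk fun k => coeff k (U x s (k+1))

lemma LL_spec {x : ℕ → R⟦X⟧} (hx : ∀ d, (X : R⟦X⟧) ^ d ∣ x d) {s : List ℕ} (hs : Pos s) (b : ℕ) :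
    (X : R⟦X⟧) ^ b ∣ LL x s - U x s b := by
  rw [X_pow_dvd_iff]
  intro k hk
  rw [map_sub, LL, coeff_mk]
  have := X_dvd_U hx hs (show k + 1 ≤ b by omega)
  rw [X_pow_dvd_iff] at this
  have := this k (by omega)
  rw [map_sub, sub_eq_zero] at this
  rw [this, sub_self]

lemma LL_unique {y z : R⟦X⟧} (h : ∀ b : ℕ, (X : R⟦X⟧) ^ b ∣ y - z) : y = z := by
  ext k
  have := X_pow_dvd_iff.1 (h (k+1)) k (by omega)
  rwa [map_sub, sub_eq_zero] at this

lemma LL_nil (x : ℕ → R⟦X⟧) : LL x [] = 1 := by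
  ext k; rw [LL, coeff_mk, U_nil]

lemma LL_map {S : Type*} [CommRing S] (φ : R →+* S) (x : ℕ → R⟦X⟧) (s : List ℕ) :
    PowerSeries.map φ (LL x s) = LL (fun d => PowerSeries.map φ (x d)) s := by
  ext k
  rw [coeff_map, LL, LL, coeff_mk, coeff_mk, ← U_map, coeff_map]

lemma LL_hom (φ : R⟦X⟧ →+* R⟦X⟧) (hφ : ∀ f (b : ℕ), (X : R⟦X⟧) ^ b ∣ f → (X : R⟦X⟧) ^ b ∣ φ f)
    {x : ℕ → R⟦X⟧} (hx : ∀ d, (X : R⟦X⟧) ^ d ∣ x d) {s : List ℕ} (hs : Pos s) :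
    φ (LL x s) = LL (fun d => φ (x d)) s := by
  apply LL_unique
  intro b
  have h1 := hφ _ b (LL_spec hx hs b)
  have h2 := LL_spec (x := fun d => φ (x d)) (fun d => hφ _ _ (hx d)) hs b
  rw [map_sub, U_map] at h1
  have := dvd_sub h1 h2
  simpa using this

lemma LL_step {x x' : ℕ → R⟦X⟧} (hx : ∀ d, (X : R⟦X⟧) ^ d ∣ x d) (hx' : ∀ d, (X : R⟦X⟧) ^ d ∣ x' d)
    (m : R⟦X⟧) (h0 : x 0 = 1) (h1 : ∀ d, x (d+1) = m * x' d)
    (s : List ℕ) (k : ℕ) (hs : Pos s) (hk : 0 < k) :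
    LL x (s ++ [k]) = m ^ (s.sum + k) * LL x' (s ++ [k]) + m ^ s.sum * LL x' s := by
  have hsk : Pos (s ++ [k]) := by
    intro j hj; simp at hj; rcases hj with h | h
    · exact hs j h
    · omega
  apply LL_unique
  intro b
  have a1 := (pow_dvd_pow X (Nat.le_succ b)).trans (LL_spec hx hsk (b+1))
  have a2 := LL_spec hx' hsk b
  have a3 := LL_spec hx' hs b
  rw [U_step x x' m h0 h1] at a1
  have := dvd_sub (dvd_sub a1 (a2.mul_left (m ^ (s.sum + k)))) (a3.mul_left (m ^ s.sum))
  convert this using 1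
  ring

/-- formal Carlitz polylogarithms, lists with the smallest index first. -/
def LS (q : ℕ) (t : R) (s : List ℕ) : R⟦X⟧ := LL (MS q t) s.reverse

lemma LS_map {S : Type*} [CommRing S] (φ : R →+* S) (hq : q ≠ 0) (t : R) (s : List ℕ) :
    PowerSeries.map φ (LS q t s) = LS q (φ t) s := by
  rw [LS, LL_map, LS]
  simp only [MS_map φ hq]

end Formal

section FormalFE
open PowerSeries
variable (F : Type) [Field F] [Fintype F]

/-- Frobenius -/
def Fr : F⟦X⟧ →+* F⟦X⟧ := (FiniteField.frobeniusAlgHom F F⟦X⟧).toRingHom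

lemma Fr_apply (f : F⟦X⟧) : Fr F f = f ^ qc F := rfl

lemma qc_ne : qc F ≠ 0 := by have := one_lt_qc (F := F); omega

lemma MS_zero_succ (d : ℕ) : MS (qc F) (0:F) (d+1) = (-X) * Fr F (MS (qc F) (0:F) d) := by
  have e : ∀ d, MS (qc F) (0:F) d = ∏ i ∈ Finset.range d, -((X : F⟦X⟧) ^ (qc F ^ i)) := by
    intro d
    rw [MS]
    refine Finset.prod_congr rfl fun i _ => ?_
    have : gi (1 - C (0:F) * X ^ (qc F ^ i)) = 1 := by
      symm; apply gi_unique <;> simp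
    rw [this, mul_one]
  rw [e, e, map_prod, Finset.prod_range_succ', mul_comm]
  congr 1
  · simp
  · refine Finset.prod_congr rfl fun i _ => ?_
    rw [map_neg, Fr_apply, ← pow_mul, pow_succ]

lemma FE_formal : FE (Polynomial.coeToPowerSeries.ringHom (R := F)) (-Polynomial.X) (qc F)
    (fun s => LS (qc F) (0:F) s) := by
  constructor
  · simp [LS, LL_nil]
  · intro k s hs
    obtain ⟨hk, hs⟩ := Pos_cons.1 hs
    have hsr : Pos s.reverse := fun j hj => hs j (List.mem_reverse.1 hj)
    have hFr : ∀ (f : F⟦X⟧) (b : ℕ), (X : F⟦X⟧) ^ b ∣ f → (X : F⟦X⟧) ^ b ∣ Fr F f := by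
      intro f b h
      rw [Fr_apply]; exact h.trans (dvd_pow_self _ (qc_ne F))
    have hM := X_dvd_MS (qc_ne F) (0:F)
    have hsk : Pos (s.reverse ++ [k]) := by
      intro j hj; simp at hj; rcases hj with h | h
      · exact hs j h
      · omega
    have := LL_step (x := MS (qc F) (0:F)) hM (fun d => hFr _ _ (hM d)) (-X) (by simp [MS]) (MS_zero_succ F)
      s.reverse k hsr hk
    rw [← LL_hom _ hFr hM hsk, ← LL_hom _ hFr hM hsr, List.sum_reverse] at this
    simpa [LS, Fr_apply] using this
end FormalFE

section Siegel
variable {F : Type} [Field F]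
open Polynomial

lemma siegelP {ι κ : Type*} [Fintype ι] [Fintype κ] (G : (ι → F) → κ → F[X])
    (hadd : ∀ x y k, G (x + y) k = G x k + G y k) (hsmul : ∀ (a : F) x k, G (a • x) k = a • G x k)
    (E : κ → ℕ) (hE : ∀ x k m, E k ≤ m → (G x k).coeff m = 0)
    (h : ∑ k, E k < Fintype.card ι) : ∃ x, x ≠ 0 ∧ ∀ k, G x k = 0 := by
  let f : (ι → F) →ₗ[F] ((Σ k, Fin (E k)) → F) :=
    { toFun := fun x p => (G x p.1).coeff p.2
      map_add' := fun x y => by ext1 p; simp [hadd]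
      map_smul' := fun a x => by ext1 p; simp [hsmul] }
  have hk : LinearMap.ker f ≠ ⊥ := by
    apply LinearMap.ker_ne_bot_of_finrank_lt
    simpa using h
  obtain ⟨x, hx, hx0⟩ := (Submodule.ne_bot_iff _).1 hk
  refine ⟨x, hx0, fun k => ?_⟩
  ext m
  by_cases hm : m < E k
  · exact congrFun (LinearMap.mem_ker.1 hx) ⟨k, m, hm⟩
  · rw [hE x k m (by omega), coeff_zero]
end Siegel

section ZE
open PowerSeries
variable {F : Type} [Field F] [Fintype F] {W : ℕ}

lemma Frn (j : ℕ) : ∃ φ : F⟦X⟧ →+* F⟦X⟧, ∀ f, φ f = f ^ (qc F ^ j) := by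
  induction j with
  | zero => exact ⟨RingHom.id _, by simp⟩
  | succ j ih =>
    obtain ⟨φ, hφ⟩ := ih
    refine ⟨(Fr F).comp φ, fun f => ?_⟩
    rw [RingHom.comp_apply, hφ, Fr_apply, ← pow_mul, pow_succ]

open scoped RatFunc in
lemma indF (c : GI (qc F) W → Polynomial F)
    (h : ∑ s, ((c s : Polynomial F) : F⟦X⟧) * LS (qc F) (0:F) s.1 = 0) : c = 0 := by
  have hFE := FE_formal F
  have key := IND (q := qc F) (W := W) (ι := algebraMap (RatFunc F) (LaurentSeries F)) (m := -RatFunc.X)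
    (g := fun s => HahnSeries.ofPowerSeries ℤ F (LS (qc F) (0:F) s)) (RatFunc.inftyValuation F)
    (by rw [Valuation.map_neg, RatFunc.inftyValuation.X])
    ⟨by have := hFE.1; simp only at this; simp only [this, map_one], fun k s hs => by
      have := congrArg (HahnSeries.ofPowerSeries ℤ F) (hFE.2 k s hs)
      simp only [map_add, map_mul, map_pow] at this
      have e : HahnSeries.ofPowerSeries ℤ F (Polynomial.coeToPowerSeries.ringHom (-Polynomial.X)) =
        algebraMap (RatFunc F) (LaurentSeries F) (-RatFunc.X) := by
        rw [map_neg, map_neg, map_neg, RatFunc.coe_X]; simp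
      rw [e] at this
      exact this⟩
    (fun a => by
      have := map_sum (FiniteField.frobeniusAlgHom F (LaurentSeries F)) a Finset.univ
      exact this)
    one_lt_qc (fun s => (c s : RatFunc F)) (by
      have := congrArg (HahnSeries.ofPowerSeries ℤ F) h
      rw [map_sum, map_zero] at this
      rw [← this]
      refine Finset.sum_congr rfl fun s _ => ?_
      rw [map_mul, RatFunc.coe_coe])
  ext1 s
  have := congrFun key s
  exact RatFunc.algebraMap_injective F (by simpa [RatFunc.coePolynomial] using this)

lemma FE_pow (j : ℕ) : FE (Polynomial.coeToPowerSeries.ringHom (R := F)) ((-Polynomial.X) ^ (qc F ^ j)) (qc F)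
    (fun s => LS (qc F) (0:F) s ^ (qc F ^ j)) := by
  have h := FE_formal F
  obtain ⟨φ, hφ⟩ := Frn (F := F) j
  refine ⟨?_, fun k s hs => ?_⟩
  · have := h.1
    simp only at this
    simp [this]
  · have := congrArg φ (h.2 k s hs)
    simp only [map_add, map_mul φ, map_pow φ] at this
    simp only [hφ] at this
    simpa [map_pow] using this

lemma PP_natDegree {q : ℕ} {c : GI q W → Polynomial F} {D : ℕ} (h : ∀ s, (c s).natDegree ≤ D) (s : GI q W) :
    (PP c s).natDegree ≤ D := by
  rw [PP]
  refine Polynomial.natDegree_add_le_of_degree_le (h s) (Polynomial.natDegree_sum_le_of_forall_le _ _ fun t _ => ?_)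
  split_ifs
  · exact h t
  · simp

lemma push (D : ℕ) (c : GI (qc F) W → Polynomial F) (hD : ∀ s, (c s).natDegree ≤ D) (i j : ℕ) (hij : i ≤ j) :
    ∃ C : GI (qc F) W → Polynomial F, (∀ s, (C s).natDegree ≤ qc F ^ j * (D + W)) ∧
      (∑ s, ((c s : Polynomial F) : F⟦X⟧) * LS (qc F) (0:F) s.1) ^ (qc F ^ i) =
      ∑ s, ((C s : Polynomial F) : F⟦X⟧) * LS (qc F) (0:F) s.1 ^ (qc F ^ j) := by
  induction j, hij using Nat.le_induction with
  | base =>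
    refine ⟨fun s => c s ^ (qc F ^ i), fun s => ?_, ?_⟩
    · refine Polynomial.natDegree_pow_le.trans ?_
      exact Nat.mul_le_mul_left _ ((hD s).trans (Nat.le_add_right _ _))
    · obtain ⟨φ, hφ⟩ := Frn (F := F) i
      rw [← hφ, map_sum]
      refine Finset.sum_congr rfl fun s _ => ?_
      rw [hφ, mul_pow, Polynomial.coe_pow]
  | succ j hj ih =>
    obtain ⟨C, hC, hE⟩ := ih
    refine ⟨PL ((-Polynomial.X) ^ (qc F ^ j)) (qc F) W C, fun s => ?_, ?_⟩
    · rw [PL_apply]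
      refine Polynomial.natDegree_mul_le.trans ?_
      have h1 := PP_natDegree hC s
      have h2 : (((-Polynomial.X : Polynomial F) ^ (qc F ^ j)) ^ s.1.sum).natDegree ≤ qc F ^ j * W := by
        rw [← pow_mul]
        refine Polynomial.natDegree_pow_le.trans ?_
        rw [Polynomial.natDegree_neg, Polynomial.natDegree_X, mul_one]
        exact Nat.mul_le_mul_left _ s.2.2.2
      have h3 : 2 ≤ qc F := one_lt_qc
      have h4 : qc F ^ j * 2 * (D + W) ≤ qc F ^ (j+1) * (D + W) := by
        rw [pow_succ]; exact Nat.mul_le_mul_right _ (Nat.mul_le_mul_left _ h3)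
      nlinarith [Nat.zero_le (qc F ^ j * D)]
    · rw [hE]
      have := FE_sum (FE_pow (F := F) j) C
      simp only [Polynomial.coeToPowerSeries.ringHom_apply] at this
      rw [this]
      refine Finset.sum_congr rfl fun s _ => ?_
      rw [← pow_mul, pow_succ]

lemma X_dvd_cancel {f g : F⟦X⟧} (hg : constantCoeff g ≠ 0) {n : ℕ} (h : (X : F⟦X⟧) ^ n ∣ f * g) :
    (X : F⟦X⟧) ^ n ∣ f := by
  have : IsUnit g := by rw [PowerSeries.isUnit_iff_constantCoeff]; exact hg.isUnit
  exact (this.dvd_mul_right).1 h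

/-- zero estimate -/
lemma zero_est (D : ℕ) (c : GI (qc F) W → Polynomial F) (hc : c ≠ 0) (hD : ∀ s, (c s).natDegree ≤ D) :
    ∃ k ≤ Fintype.card (GI (qc F) W) * (qc F ^ Fintype.card (GI (qc F) W) * (D + W)),
      coeff k (∑ s, ((c s : Polynomial F) : F⟦X⟧) * LS (qc F) (0:F) s.1) ≠ 0 := by
  set n := Fintype.card (GI (qc F) W) with hn
  set M := qc F ^ n * (D + W) with hM
  set E := ∑ s, ((c s : Polynomial F) : F⟦X⟧) * LS (qc F) (0:F) s.1 with hE
  have hE0 : E ≠ 0 := fun h => hc (indF c h)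
  have hq : 2 ≤ qc F := one_lt_qc
  choose C hC1 hC2 using fun i : Fin (n+1) => push (F := F) (W := W) D c hD i n (by omega)
  obtain ⟨x, hx, hxk⟩ := siegelP (F := F) (ι := Fin (n+1) × Fin (n * M + 1)) (κ := GI (qc F) W)
    (fun x s => ∑ i, Polynomial.ofFn (n * M + 1) (fun j => x (i, j)) * C i s)
    (fun x y s => by
      rw [← Finset.sum_add_distrib]
      refine Finset.sum_congr rfl fun i _ => ?_
      rw [← add_mul, ← map_add]; rfl)
    (fun a x s => by
      rw [Finset.smul_sum]
      refine Finset.sum_congr rfl fun i _ => ?_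
      rw [← smul_mul_assoc, ← map_smul]; rfl)
    (fun _ => n * M + 1 + M)
    (fun x s m hm => by
      rw [Polynomial.finsetSum_coeff]
      refine Finset.sum_eq_zero fun i _ => ?_
      apply Polynomial.coeff_eq_zero_of_natDegree_lt
      refine lt_of_le_of_lt Polynomial.natDegree_mul_le ?_
      have h1 := Polynomial.ofFn_natDegree_lt (R := F) (n := n * M + 1) (by omega) (fun j => x (i, j))
      have h2 := hC1 i s
      omega)
    (by
      rw [Finset.sum_const, Finset.card_univ, ← hn, Fintype.card_prod, Fintype.card_fin, Fintype.card_fin, smul_eq_mul]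
      ring_nf; omega)
  set b : ℕ → Polynomial F := fun i => if h : i < n + 1 then
    Polynomial.ofFn (n * M + 1) (fun j => x (⟨i, h⟩, j)) else 0 with hb
  have hbE : ∑ i ∈ Finset.range (n+1), (b i : F⟦X⟧) * E ^ (qc F ^ i) = 0 := by
    rw [Finset.sum_range]
    have : ∀ i : Fin (n+1), (b i : F⟦X⟧) * E ^ (qc F ^ (i:ℕ)) =
        ∑ s, ((Polynomial.ofFn (n * M + 1) (fun j => x (i, j)) * C i s : Polynomial F) : F⟦X⟧) * LS (qc F) (0:F) s.1 ^ (qc F ^ n) := by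
      intro i
      rw [hE, hC2 i, Finset.mul_sum]
      refine Finset.sum_congr rfl fun s _ => ?_
      rw [Polynomial.coe_mul, mul_assoc]
      simp only [hb, i.2, dif_pos, Fin.eta]
    simp only [this]
    rw [Finset.sum_comm]
    refine Finset.sum_eq_zero fun s _ => ?_
    rw [← Finset.sum_mul]
    have h2 := congrArg (Polynomial.coeToPowerSeries.ringHom (R := F)) (hxk s)
    rw [map_sum, map_zero] at h2
    simp only [Polynomial.coeToPowerSeries.ringHom_apply] at h2
    rw [h2, zero_mul]
  have hbdeg : ∀ i, (b i).natDegree ≤ n * M := by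
    intro i
    simp only [hb]
    split_ifs with h
    · have h1 := Polynomial.ofFn_natDegree_lt (R := F) (n := n * M + 1) (by omega) (fun j => x (⟨i, h⟩, j))
      omega
    · simp
  have hbex : ∃ i, i < n + 1 ∧ b i ≠ 0 := by
    by_contra hcon
    push Not at hcon
    apply hx
    ext ⟨i, j⟩
    have h1 := hcon i i.2
    simp only [hb, i.2, dif_pos] at h1
    have h2 := congrArg (fun p => Polynomial.coeff p j) h1
    simp only [Polynomial.coeff_zero] at h2
    rw [Polynomial.ofFn_coeff_eq_val_of_lt _ j.2] at h2
    exact h2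
  obtain ⟨i0, hi0n, hbi0, hi0min⟩ : ∃ i0, i0 < n + 1 ∧ b i0 ≠ 0 ∧ ∀ i < i0, ¬ (i < n + 1 ∧ b i ≠ 0) :=
    ⟨Nat.find hbex, (Nat.find_spec hbex).1, (Nat.find_spec hbex).2, fun i hi => Nat.find_min hbex hi⟩
  by_contra hcon
  push Not at hcon
  have hXE : (X : F⟦X⟧) ^ (n * M + 1) ∣ E := by
    rw [X_pow_dvd_iff]; intro k hk; exact hcon k (by omega)
  -- write E = X^e E'
  obtain ⟨e, E', hE', hEe⟩ : ∃ (e : ℕ) (E' : F⟦X⟧), constantCoeff E' ≠ 0 ∧ E = X ^ e * E' := by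
    refine ⟨E.order.toNat, divXPowOrder E, ?_, (X_pow_order_mul_divXPowOrder).symm⟩
    rw [constantCoeff_divXPowOrder]
    exact coeff_order hE0
  have he : n * M + 1 ≤ e := by
    by_contra hlt
    rw [hEe] at hXE
    have := X_dvd_cancel hE' hXE
    rw [X_pow_dvd_iff] at this
    have := this e (by omega)
    simp [coeff_X_pow] at this
  have h1 : (X : F⟦X⟧) ^ (qc F ^ i0 * e + e) ∣ (b i0 : F⟦X⟧) * E ^ (qc F ^ i0) := by
    have hsplit : (b i0 : F⟦X⟧) * E ^ (qc F ^ i0) = - ∑ i ∈ (Finset.range (n+1)).erase i0, (b i : F⟦X⟧) * E ^ (qc F ^ i) := by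
      rw [eq_neg_iff_add_eq_zero, Finset.add_sum_erase _ (fun i => (b i : F⟦X⟧) * E ^ (qc F ^ i)) (Finset.mem_range.2 hi0n)]
      exact hbE
    rw [hsplit, dvd_neg]
    refine Finset.dvd_sum fun i hi => ?_
    rw [Finset.mem_erase, Finset.mem_range] at hi
    by_cases hii : i < i0
    · have : b i = 0 := by
        by_contra hne
        exact hi0min i hii ⟨hi.2, hne⟩
      rw [this]; simp
    · refine Dvd.dvd.mul_left ?_ _
      have h2 : i0 + 1 ≤ i := by omega
      have h3 : qc F ^ (i0 + 1) ≤ qc F ^ i := Nat.pow_le_pow_right (by omega) h2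
      have h4 : 1 ≤ qc F ^ i0 := Nat.one_le_pow _ _ (by omega)
      have h5 : qc F ^ i0 + 1 ≤ qc F ^ i := by
        rw [pow_succ] at h3; nlinarith
      rw [hEe, mul_pow, ← pow_mul]
      refine Dvd.dvd.mul_right (pow_dvd_pow _ ?_) _
      calc qc F ^ i0 * e + e = (qc F ^ i0 + 1) * e := by ring
        _ ≤ qc F ^ i * e := Nat.mul_le_mul_right _ h5
        _ = e * qc F ^ i := mul_comm _ _
  have h2 : (X : F⟦X⟧) ^ e ∣ (b i0 : F⟦X⟧) := by
    rw [hEe, mul_pow, ← pow_mul, mul_comm e, pow_add, mul_left_comm] at h1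
    have h3 := (mul_dvd_mul_iff_left (pow_ne_zero _ X_ne_zero)).1 h1
    exact X_dvd_cancel (by rw [map_pow]; exact pow_ne_zero _ hE') h3
  apply hbi0
  rw [X_pow_dvd_iff] at h2
  ext k
  by_cases hk : k < e
  · have := h2 k hk
    rwa [Polynomial.coeff_coe] at this
  · rw [Polynomial.coeff_zero]
    apply Polynomial.coeff_eq_zero_of_natDegree_lt
    have := hbdeg i0
    omega
end ZE

section EvSec
open PowerSeries
variable {F : Type} [Field F]

/-- growth condition on coefficients -/
def AA (B : ℤ) (f : (KinfQ F)⟦X⟧) : Prop := ∀ k : ℕ, dle (coeff k f) (B + k)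

lemma AA_mono {B B' : ℤ} {f : (KinfQ F)⟦X⟧} (h : AA B f) (hB : B ≤ B') : AA B' f :=
  fun k => dle_mono (h k) (by omega)
lemma AA_add {B : ℤ} {f g : (KinfQ F)⟦X⟧} (hf : AA B f) (hg : AA B g) : AA B (f + g) :=
  fun k => by rw [map_add]; exact dle_add (hf k) (hg k)
lemma AA_neg {B : ℤ} {f : (KinfQ F)⟦X⟧} (hf : AA B f) : AA B (-f) :=
  fun k => by rw [map_neg]; exact dle_neg (hf k)
lemma AA_sub {B : ℤ} {f g : (KinfQ F)⟦X⟧} (hf : AA B f) (hg : AA B g) : AA B (f - g) := by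
  rw [sub_eq_add_neg]; exact AA_add hf (AA_neg hg)
lemma AA_mul {B B' : ℤ} {f g : (KinfQ F)⟦X⟧} (hf : AA B f) (hg : AA B' g) : AA (B + B') (f * g) := by
  intro k
  rw [coeff_mul]
  refine dle_sum _ fun p hp => ?_
  replace hp := Finset.HasAntidiagonal.mem_antidiagonal.1 hp
  exact dle_mono (dle_mul (hf p.1) (hg p.2)) (by omega)
lemma AA_C {B : ℤ} {y : KinfQ F} (h : dle y B) : AA B (C y) := by
  intro k
  rw [coeff_C]
  split_ifs with hk
  · exact dle_mono h (by omega)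
  · exact dle_zero _
lemma AA_X : AA 0 (X : (KinfQ F)⟦X⟧) := by
  intro k
  rw [coeff_X]
  split_ifs with hk
  · exact dle_mono dle_one (by omega)
  · exact dle_zero _
lemma AA_zero (B : ℤ) : AA B (0 : (KinfQ F)⟦X⟧) := fun k => by rw [map_zero]; exact dle_zero _

lemma AA_gi {f : (KinfQ F)⟦X⟧} (hf : AA 0 f) : AA 0 (gi f) := by
  intro k
  induction k using Nat.strong_induction_on with
  | _ k ih =>
    rw [gi, coeff_invOfUnit]
    split_ifs with hk
    · simpa [hk] using dle_one
    · simp only [inv_one, Units.val_one, neg_mul, one_mul]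
      refine dle_neg (dle_sum _ fun p hp => ?_)
      replace hp := Finset.HasAntidiagonal.mem_antidiagonal.1 hp
      split_ifs with h2
      · exact dle_mono (dle_mul (hf p.1) (ih p.2 h2)) (by omega)
      · exact dle_zero _

/-- geometric series -/
def geo (F : Type) [Field F] (a : ℕ) : (KinfQ F)⟦X⟧ := gi (1 - C (thetaQ F ^ a) * X)

lemma geo_mul (a : ℕ) : (1 - C (thetaQ F ^ a) * X) * geo F a = 1 := by
  apply gi_mul; simp

lemma geo_const (a : ℕ) : constantCoeff (geo F a) = 1 := by
  apply gi_const; simp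

/-- evaluation at `θ^{-a}` -/
def Ev (a : ℕ) (B : ℤ) (f : (KinfQ F)⟦X⟧) (y : KinfQ F) : Prop :=
  AA B f ∧ dle y B ∧ AA B ((f - C y) * geo F a)

lemma Ev_mono {a : ℕ} {B B' : ℤ} {f : (KinfQ F)⟦X⟧} {y : KinfQ F} (h : Ev a B f y) (hB : B ≤ B') : Ev a B' f y :=
  ⟨AA_mono h.1 hB, dle_mono h.2.1 hB, AA_mono h.2.2 hB⟩

lemma Ev_C (a : ℕ) {B : ℤ} {y : KinfQ F} (h : dle y B) : Ev a B (C y) y :=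
  ⟨AA_C h, h, by rw [sub_self, zero_mul]; exact AA_zero _⟩

lemma Ev_zero (a : ℕ) (B : ℤ) : Ev a B (0 : (KinfQ F)⟦X⟧) 0 := by
  have := Ev_C (F := F) a (dle_zero B); rwa [map_zero] at this
lemma Ev_one (a : ℕ) : Ev a 0 (1 : (KinfQ F)⟦X⟧) 1 := by
  have := Ev_C (F := F) a dle_one; rwa [map_one] at this

lemma Ev_add {a : ℕ} {B : ℤ} {f g : (KinfQ F)⟦X⟧} {y z : KinfQ F} (hf : Ev a B f y) (hg : Ev a B g z) :
    Ev a B (f + g) (y + z) :=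
  ⟨AA_add hf.1 hg.1, dle_add hf.2.1 hg.2.1, by
    have := AA_add hf.2.2 hg.2.2
    convert this using 1; rw [map_add]; ring⟩

lemma Ev_neg {a : ℕ} {B : ℤ} {f : (KinfQ F)⟦X⟧} {y : KinfQ F} (hf : Ev a B f y) : Ev a B (-f) (-y) :=
  ⟨AA_neg hf.1, dle_neg hf.2.1, by
    have := AA_neg hf.2.2
    convert this using 1; rw [map_neg]; ring⟩

lemma Ev_mul {a : ℕ} {B B' : ℤ} {f g : (KinfQ F)⟦X⟧} {y z : KinfQ F} (hf : Ev a B f y) (hg : Ev a B' g z) :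
    Ev a (B + B') (f * g) (y * z) :=
  ⟨AA_mul hf.1 hg.1, dle_mul hf.2.1 hg.2.1, by
    have := AA_add (AA_mul hf.2.2 hg.1) (AA_mul (AA_C hf.2.1) hg.2.2)
    convert this using 1; rw [map_mul]; ring⟩

lemma Ev_mul0 {a : ℕ} {f g : (KinfQ F)⟦X⟧} {y z : KinfQ F} (hf : Ev a 0 f y) (hg : Ev a 0 g z) :
    Ev a 0 (f * g) (y * z) := by
  have := Ev_mul hf hg; rwa [add_zero] at this

lemma Ev_pow {a : ℕ} {f : (KinfQ F)⟦X⟧} {y : KinfQ F} (hf : Ev a 0 f y) (n : ℕ) :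
    Ev a 0 (f ^ n) (y ^ n) := by
  induction n with
  | zero => simpa using Ev_one a
  | succ n ih => rw [pow_succ, pow_succ]; exact Ev_mul0 ih hf

lemma Ev_prod {a : ℕ} {ι : Type*} (S : Finset ι) {f : ι → (KinfQ F)⟦X⟧} {y : ι → KinfQ F}
    (h : ∀ i ∈ S, Ev a 0 (f i) (y i)) : Ev a 0 (∏ i ∈ S, f i) (∏ i ∈ S, y i) := by
  induction S using Finset.induction_on with
  | empty => simpa using Ev_one a
  | insert i S hi ih =>
    rw [Finset.prod_insert hi, Finset.prod_insert hi]
    exact Ev_mul0 (h i (by simp)) (ih fun j hj => h j (by simp [hj]))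

lemma Ev_sum {a : ℕ} {B : ℤ} {ι : Type*} (S : Finset ι) {f : ι → (KinfQ F)⟦X⟧} {y : ι → KinfQ F}
    (h : ∀ i ∈ S, Ev a B (f i) (y i)) : Ev a B (∑ i ∈ S, f i) (∑ i ∈ S, y i) := by
  induction S using Finset.induction_on with
  | empty => simpa using Ev_zero a B
  | insert i S hi ih =>
    rw [Finset.sum_insert hi, Finset.sum_insert hi]
    exact Ev_add (h i (by simp)) (ih fun j hj => h j (by simp [hj]))

lemma dle_alpha (a : ℕ) : dle ((thetaQ F ^ a)⁻¹) (-a) := by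
  have := dle_theta_zpow (F := F) (-(a:ℤ))
  rwa [zpow_neg, zpow_natCast] at this

lemma sub_alpha_geo (a : ℕ) : (X - C ((thetaQ F ^ a)⁻¹)) * geo F a = - C ((thetaQ F ^ a)⁻¹) := by
  have h : (X - C ((thetaQ F ^ a)⁻¹) : (KinfQ F)⟦X⟧) = - C ((thetaQ F ^ a)⁻¹) * (1 - C (thetaQ F ^ a) * X) := by
    have : (C ((thetaQ F ^ a)⁻¹) * C (thetaQ F ^ a) : (KinfQ F)⟦X⟧) = 1 := by
      rw [← map_mul, inv_mul_cancel₀ (pow_ne_zero _ theta_ne), map_one]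
    linear_combination (-X) * this
  rw [h, mul_assoc, geo_mul, mul_one]

lemma Ev_X (a : ℕ) : Ev a 0 (X : (KinfQ F)⟦X⟧) ((thetaQ F ^ a)⁻¹) := by
  refine ⟨AA_X, dle_mono (dle_alpha a) (by omega), ?_⟩
  rw [sub_alpha_geo]
  exact AA_neg (AA_C (dle_mono (dle_alpha a) (by omega)))

lemma Ev_thetaX {a : ℕ} (ha : 1 ≤ a) : Ev a 0 (C (thetaQ F) * X : (KinfQ F)⟦X⟧) (thetaQ F * (thetaQ F ^ a)⁻¹) := by
  have h1 : dle (thetaQ F * (thetaQ F ^ a)⁻¹) 0 := dle_mono (dle_mul dle_theta (dle_alpha a)) (by omega)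
  refine ⟨?_, h1, ?_⟩
  · intro k
    rw [coeff_C_mul, coeff_X]
    split_ifs with hk
    · rw [mul_one]; exact dle_mono dle_theta (by omega)
    · rw [mul_zero]; exact dle_zero _
  · rw [map_mul, ← mul_sub, mul_assoc, sub_alpha_geo, mul_neg, ← map_mul]
    exact AA_neg (AA_C h1)

lemma Ev_gi {a : ℕ} {f : (KinfQ F)⟦X⟧} {y : KinfQ F} (hf : Ev a 0 f y) (hc : constantCoeff f = 1)
    (hy : y ≠ 0) (hy' : dle y⁻¹ 0) : Ev a 0 (gi f) y⁻¹ := by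
  refine ⟨AA_gi hf.1, hy', ?_⟩
  have := AA_neg (AA_mul (AA_mul hf.2.2 (AA_gi hf.1)) (AA_C hy'))
  replace this := AA_mono this (show (0:ℤ) + 0 + 0 ≤ 0 by norm_num)
  convert this using 1
  have h1 : f * gi f = 1 := gi_mul hc
  have h2 : (C y * C y⁻¹ : (KinfQ F)⟦X⟧) = 1 := by rw [← map_mul, mul_inv_cancel₀ hy, map_one]
  clear this hf hy hy' hc
  have key : ∀ (R : Type) [CommRing R] (f' g c c' i : R), f' * i = 1 → c * c' = 1 →
      (i - c') * g = -((f' - c) * g * i * c') := by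
    intro R _ f' g c c' i h1 h2
    linear_combination (g * c') * h1 - i * g * h2
  exact key _ _ _ _ _ _ h1 h2

lemma Ev_factor {a k : ℕ} (ha : 2 ≤ a) (hk : 1 ≤ k) :
    Ev a 0 (-(X ^ k) * gi (1 - C (thetaQ F) * X ^ k) : (KinfQ F)⟦X⟧) (1 / (thetaQ F - thetaQ F ^ (a * k))) := by
  have hak : 1 < a * k := by nlinarith
  have hne := sub_theta_ne (F := F) hak
  have hth : thetaQ F ^ (a * k) ≠ 0 := pow_ne_zero _ theta_ne
  set y := 1 + -(thetaQ F * (thetaQ F ^ a)⁻¹ * (thetaQ F ^ a)⁻¹ ^ (k-1)) with hy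
  have hα : (thetaQ F ^ a)⁻¹ * (thetaQ F ^ a)⁻¹ ^ (k-1) = (thetaQ F ^ (a*k))⁻¹ := by
    rw [← pow_succ', Nat.sub_add_cancel hk, inv_pow, ← pow_mul]
  have hye : y = - (thetaQ F - thetaQ F ^ (a*k)) * (thetaQ F ^ (a*k))⁻¹ := by
    rw [hy, mul_assoc, hα]; field_simp; ring
  have hyi : y⁻¹ = -(thetaQ F ^ (a*k)) * (1 / (thetaQ F - thetaQ F ^ (a*k))) := by
    rw [hye, mul_inv, inv_inv, inv_neg]; ring
  have hy0 : y ≠ 0 := by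
    rw [hye]; exact mul_ne_zero (neg_ne_zero.2 hne) (inv_ne_zero hth)
  have h1 : Ev a 0 (1 - C (thetaQ F) * X ^ k : (KinfQ F)⟦X⟧) y := by
    have := Ev_add (Ev_one a) (Ev_neg (Ev_mul0 (Ev_thetaX (F := F) (a := a) (by omega)) (Ev_pow (Ev_X (F := F) a) (k-1))))
    convert this using 1
    rw [mul_assoc, ← pow_succ', Nat.sub_add_cancel hk]; ring
  have h2 := Ev_gi h1 (cc_one_sub _ (by omega)) hy0 (by
    rw [hyi]
    refine dle_mono (dle_mul (dle_neg (dle_theta_pow (a*k))) (dle_inv_sub hak)) ?_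
    simp)
  have h3 := Ev_mul0 (Ev_neg (Ev_pow (Ev_X (F := F) a) k)) h2
  convert h3 using 1
  rw [hyi, inv_pow, ← pow_mul]
  field_simp

lemma Ev_U {a : ℕ} {f : ℕ → (KinfQ F)⟦X⟧} {y : ℕ → KinfQ F} (h : ∀ d, Ev a 0 (f d) (y d)) (s : List ℕ) (b : ℕ) :
    Ev a 0 (U f s b) (U y s b) := by
  induction s generalizing b with
  | nil => rw [U_nil, U_nil]; exact Ev_one a
  | cons k s ih =>
    rw [U_cons, U_cons]
    exact Ev_sum _ fun d _ => Ev_mul0 (Ev_pow (h d) k) (ih d)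

lemma Ev_LL {a : ℕ} {f : ℕ → (KinfQ F)⟦X⟧} {y : ℕ → KinfQ F} (h : ∀ d, Ev a 0 (f d) (y d))
    (hf : ∀ d, (X : (KinfQ F)⟦X⟧) ^ d ∣ f d) (hy : ∀ d : ℕ, dle (y d) (-d)) {s : List ℕ} (hs : Pos s) :
    Ev a 0 (LL f s) (Ulim y s) := by
  refine ⟨fun k => ?_, Ulim_dle hy hs, fun k => ?_⟩
  · rw [LL, coeff_mk]
    exact (Ev_U h s (k+1)).1 k
  · -- choose b
    obtain ⟨N, hN⟩ : ∃ N : ℕ, dle (coeff k (geo F a)) N := by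
      rcases eq_or_ne (coeff k (geo F a)) 0 with h0 | h0
      · exact ⟨0, by rw [h0]; exact dle_zero _⟩
      · refine ⟨(WithZero.log (Valued.v (coeff k (geo F a)))).toNat, ?_⟩
        unfold dle
        rw [← WithZero.log_le_iff_le_exp ((Valuation.ne_zero_iff _).2 h0)]
        omega
    set b := k + 1 + N with hb
    have e : (LL f s - C (Ulim y s)) * geo F a = (U f s b - C (U y s b)) * geo F a +
        (LL f s - U f s b) * geo F a + C (U y s b - Ulim y s) * geo F a := by
      rw [map_sub]; ring
    rw [e, map_add, map_add]
    refine dle_add (dle_add ((Ev_U h s b).2.2 k) ?_) ?_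
    · have := X_pow_dvd_iff.1 ((LL_spec hf hs b).mul_right (geo F a)) k (by omega)
      rw [this]; exact dle_zero _
    · rw [coeff_C_mul]
      exact dle_mono (dle_mul (Ulim_spec hy hs b) hN) (by omega)
end EvSec

section EvLS
open PowerSeries
variable {F : Type} [Field F] [Fintype F]

lemma Ev_LS (ν : ℕ) {s : List ℕ} (hs : Pos s) :
    Ev (qc F ^ (ν+1)) 0 (LS (qc F) (thetaQ F) s) (Ulim (xs F ν) s.reverse) := by
  refine Ev_LL (fun d => ?_) (X_dvd_MS (qc_ne F) _) (xs_dle F ν) (fun j hj => hs j (List.mem_reverse.1 hj))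
  rw [MS, xs]
  refine Ev_prod _ fun i _ => ?_
  have := Ev_factor (F := F) (a := qc F ^ (ν+1)) (k := qc F ^ i) (one_lt_pow F ν)
    (Nat.one_le_pow _ _ (by have := one_lt_qc (F := F); omega))
  convert this using 4
  rw [← pow_add]; congr 1; ring
end EvLS

section Grow
open PowerSeries
variable {F : Type} [Field F]

lemma geo_coeff_succ (h : (KinfQ F)⟦X⟧) (a k : ℕ) :
    coeff (k+1) (h * geo F a) = coeff (k+1) h + thetaQ F ^ a * coeff k (h * geo F a) := by
  have e : h * geo F a = h + C (thetaQ F ^ a) * ((h * geo F a) * X) := by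
    have := geo_mul (F := F) a
    linear_combination h * this
  conv_lhs => rw [e]
  rw [map_add, coeff_C_mul, coeff_succ_mul_X]

lemma improve_step {h : (KinfQ F)⟦X⟧} {C0 E : ℤ} {a : ℕ} (hh : AA C0 h) (hE : AA E (h * geo F a)) :
    AA (max E C0 - (a - 1)) (h * geo F a) := by
  intro k
  have e := geo_coeff_succ h a k
  have e2 : coeff k (h * geo F a) = (thetaQ F ^ a)⁻¹ * (coeff (k+1) (h * geo F a) - coeff (k+1) h) := by
    rw [e, add_sub_cancel_left, inv_mul_cancel_left₀ (pow_ne_zero _ theta_ne)]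
  rw [e2]
  have h1 := dle_sub (dle_mono (hE (k+1)) (m := max E C0 + (k+1)) (by push_cast; have := le_max_left E C0; omega))
    (dle_mono (hh (k+1)) (by push_cast; have := le_max_right E C0; omega))
  exact dle_mono (dle_mul (dle_alpha a) h1) (by omega)

lemma improve {h : (KinfQ F)⟦X⟧} {C0 : ℤ} {a : ℕ} (ha : 2 ≤ a) (hh : AA C0 h) (hE : ∃ E, AA E (h * geo F a)) :
    AA (C0 - (a - 1)) (h * geo F a) := by
  obtain ⟨E, hE⟩ := hE
  have : ∀ n : ℕ, AA (C0 + n) (h * geo F a) → AA C0 (h * geo F a) := by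
    intro n
    induction n with
    | zero => simp
    | succ n ih =>
      intro hn
      apply ih
      refine AA_mono (improve_step hh hn) ?_
      rw [max_eq_left (by omega)]; push_cast; omega
  have := this (E - C0).toNat (AA_mono hE (by omega))
  have := improve_step hh this
  rwa [max_self] at this

lemma geo_geo {a b : ℕ} (hab : a ≠ b) : geo F a * geo F b =
    C ((thetaQ F ^ a - thetaQ F ^ b)⁻¹) * (C (thetaQ F ^ a) * geo F a - C (thetaQ F ^ b) * geo F b) := by
  have hne : thetaQ F ^ a - thetaQ F ^ b ≠ 0 := by
    intro h
    rw [sub_eq_zero] at h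
    have := congrArg (fun z => WithZero.log (Valued.v z)) h
    simp only [v_theta_pow, WithZero.log_exp] at this
    omega
  have h1 : (C ((thetaQ F ^ a - thetaQ F ^ b)⁻¹) * (C (thetaQ F ^ a) - C (thetaQ F ^ b)) : (KinfQ F)⟦X⟧) = 1 := by
    rw [← map_sub, ← map_mul, inv_mul_cancel₀ hne, map_one]
  have h2 := geo_mul (F := F) a
  have h3 := geo_mul (F := F) b
  set c : (KinfQ F)⟦X⟧ := C ((thetaQ F ^ a - thetaQ F ^ b)⁻¹)
  set A : (KinfQ F)⟦X⟧ := C (thetaQ F ^ a)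
  set B : (KinfQ F)⟦X⟧ := C (thetaQ F ^ b)
  linear_combination (-(geo F a * geo F b)) * h1 - c * B * geo F b * h2 + c * A * geo F a * h3

lemma AA_Cmul {B : ℤ} {f : (KinfQ F)⟦X⟧} (y : KinfQ F) (hf : AA B f) : ∃ B', AA B' (C y * f) := by
  rcases eq_or_ne y 0 with h0 | h0
  · exact ⟨0, by rw [h0, map_zero, zero_mul]; exact AA_zero _⟩
  · refine ⟨WithZero.log (Valued.v y) + B, AA_mul (AA_C ?_) hf⟩
    unfold dle
    rw [WithZero.exp_log ((Valuation.ne_zero_iff _).2 h0)]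

lemma multi {f : (KinfQ F)⟦X⟧} {T : ℤ} (hf : AA T f) (a : ℕ → ℕ) (ha : ∀ i, 2 ≤ a i)
    (hinj : Function.Injective a) (N : ℕ) (h : ∀ i < N, ∃ B, AA B (f * geo F (a i))) (j : ℕ) (hj : j ≤ N) :
    AA (T - ∑ i ∈ Finset.range j, ((a i : ℤ) - 1)) (f * ∏ i ∈ Finset.range j, geo F (a i)) ∧
    ∀ i, j ≤ i → i < N → ∃ B, AA B ((f * ∏ i ∈ Finset.range j, geo F (a i)) * geo F (a i)) := by
  induction j with
  | zero => simpa using ⟨hf, h⟩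
  | succ j ih =>
    obtain ⟨h1, h2⟩ := ih (by omega)
    rw [Finset.prod_range_succ, Finset.sum_range_succ, ← mul_assoc]
    refine ⟨?_, fun i hi hiN => ?_⟩
    · have := improve (ha j) h1 (h2 j le_rfl (by omega))
      convert this using 1; ring
    · have hne : a j ≠ a i := fun he => by have := hinj he; omega
      obtain ⟨B1, hB1⟩ := h2 j le_rfl (by omega)
      obtain ⟨B2, hB2⟩ := h2 i (by omega) hiN
      obtain ⟨B3, hB3⟩ := AA_Cmul (thetaQ F ^ a j) hB1
      obtain ⟨B4, hB4⟩ := AA_Cmul (thetaQ F ^ a i) hB2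
      obtain ⟨B5, hB5⟩ := AA_Cmul ((thetaQ F ^ a j - thetaQ F ^ a i)⁻¹)
        (AA_sub (AA_mono hB3 (le_max_left B3 B4)) (AA_mono hB4 (le_max_right B3 B4)))
      refine ⟨B5, ?_⟩
      convert hB5 using 1
      rw [mul_assoc, geo_geo hne]; ring

lemma coeff_low {f g : (KinfQ F)⟦X⟧} (hg : constantCoeff g = 1) {k : ℕ} (h : ∀ j < k, coeff j f = 0) :
    coeff k (f * g) = coeff k f := by
  rw [coeff_mul, Finset.sum_eq_single (k, 0)]
  · rw [coeff_zero_eq_constantCoeff_apply, hg, mul_one]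
  · intro p hp hne
    replace hp := Finset.HasAntidiagonal.mem_antidiagonal.1 hp
    rw [h p.1, zero_mul]
    by_contra hcon
    apply hne
    ext <;> simp <;> omega
  · simp

/-- the contradiction -/
lemma final_bound {f : (Polynomial F)⟦X⟧} {T : ℤ} (hf : AA T (PowerSeries.map (ev F) f)) (a : ℕ → ℕ) (ha : ∀ i, 2 ≤ a i)
    (hinj : Function.Injective a) (N : ℕ)
    (h : ∀ i < N, ∃ B, AA B (PowerSeries.map (ev F) f * geo F (a i))) {k : ℕ} (hk : coeff k f ≠ 0) :
    ∑ i ∈ Finset.range N, ((a i : ℤ) - 1) ≤ T + k := by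
  have hex : ∃ k, coeff k f ≠ 0 := ⟨k, hk⟩
  set k0 := Nat.find hex with hk0
  have hle : k0 ≤ k := Nat.find_min' hex hk
  have h1 := (multi hf a ha hinj N h N le_rfl).1 k0
  rw [coeff_low, coeff_map] at h1
  · by_contra hlt
    apply Nat.find_spec hex
    ext m
    rw [(ev_dle F).1 h1 m (by omega), Polynomial.coeff_zero]
  · rw [map_prod]; exact Finset.prod_eq_one fun i _ => geo_const _
  · intro j hj
    have := Nat.find_min hex hj
    push Not at this
    rw [coeff_map, this, map_zero]
end Grow

section Transport
variable {F : Type} [Field F] [Fintype F] {W : ℕ}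

/-- twisted values -/
def yv (ν : ℕ) (s : GI (qc F) W) : KinfQ F := Ulim (xs F ν) s.1.reverse

/-- multiplier -/
def mv (F : Type) [Field F] [Fintype F] (ν : ℕ) : KinfQ F := 1 / (thetaQ F - thetaQ F ^ qc F ^ (ν + 1))

lemma yv_step (ν : ℕ) (s : GI (qc F) W) : yv ν s =
    mv F ν ^ s.1.sum * yv (ν+1) s + if s.1 = [] then 0 else mv F ν ^ (tl s).1.sum * yv (ν+1) (tl s) := by
  obtain ⟨s, hs, h2, h3⟩ := s
  cases s with
  | nil => simp [yv, Ulim_nil (xs_dle F _)]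
  | cons k s =>
    rw [Pos_cons] at hs
    have := Ulim_step (xs_dle F ν) (xs_dle F (ν+1)) (mv F ν) (xs_zero F ν) (xs_succ F ν) s.reverse k
      (fun k hk => hs.2 k (List.mem_reverse.1 hk)) hs.1
    simp only [yv, tl, List.reverse_cons, List.tail_cons, List.sum_cons, List.sum_reverse] at this ⊢
    rw [this, if_neg (by simp), add_comm k]

/-- transported relations -/
def rr (r : GI (qc F) W → Polynomial F) : ℕ → GI (qc F) W → Polynomial F
  | 0 => r
  | ν + 1 => fun s => (Polynomial.X - Polynomial.X ^ qc F ^ (ν+1)) ^ (W - s.1.sum) * PP (rr r ν) s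

lemma Xsub_ne (ν : ℕ) : (Polynomial.X - Polynomial.X ^ qc F ^ (ν+1) : Polynomial F) ≠ 0 := by
  intro h
  have := congrArg (ev F) h
  rw [map_sub, map_pow, ev_X, map_zero] at this
  exact sub_theta_ne (one_lt_pow F ν) this

lemma rr_ne {r : GI (qc F) W → Polynomial F} (hr : r ≠ 0) (ν : ℕ) : ∃ s, rr r ν s ≠ 0 := by
  induction ν with
  | zero => exact Function.ne_iff.1 hr
  | succ ν ih =>
    obtain ⟨s, hs⟩ := PP_ne_zero (c := rr r ν) (fun h => by obtain ⟨s, hs⟩ := ih; exact hs (congrFun h s))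
    exact ⟨s, mul_ne_zero (pow_ne_zero _ (Xsub_ne ν)) hs⟩

lemma rr_sum {r : GI (qc F) W → Polynomial F} (h : ∑ s, ev F (r s) * yv 0 s = 0) (ν : ℕ) :
    ∑ s, ev F (rr r ν s) * yv ν s = 0 := by
  induction ν with
  | zero => exact h
  | succ ν ih =>
    have h1 := PP_sum (fun s => ev F (rr r ν s)) (fun s => mv F ν ^ s.1.sum * yv (ν+1) s)
    simp only [← yv_step, ih] at h1
    have hM : thetaQ F - thetaQ F ^ qc F ^ (ν + 1) ≠ 0 := sub_theta_ne (one_lt_pow F ν)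
    have h2 : ∀ s : GI (qc F) W, ev F (rr r (ν+1) s) * yv (ν+1) s =
        (thetaQ F - thetaQ F ^ qc F ^ (ν + 1)) ^ W *
        (PP (fun s => ev F (rr r ν s)) s * (mv F ν ^ s.1.sum * yv (ν+1) s)) := by
      intro s
      have hW : (thetaQ F - thetaQ F ^ qc F ^ (ν + 1)) ^ W = (thetaQ F - thetaQ F ^ qc F ^ (ν + 1)) ^ (W - s.1.sum) *
          (thetaQ F - thetaQ F ^ qc F ^ (ν + 1)) ^ s.1.sum := by
        rw [← pow_add]; congr 1; have := s.2.2.2; omega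
      have hm : (thetaQ F - thetaQ F ^ qc F ^ (ν + 1)) ^ s.1.sum * mv F ν ^ s.1.sum = 1 := by
        rw [← mul_pow, mv, mul_one_div_cancel hM, one_pow]
      rw [hW]
      simp only [rr, map_mul, map_pow, map_sub, ev_X, PP_map]
      linear_combination (-((thetaQ F - thetaQ F ^ qc F ^ (ν + 1)) ^ (W - s.1.sum) *
        PP (fun s => ev F (rr r ν s)) s * yv (ν+1) s)) * hm
    rw [Finset.sum_congr rfl fun s _ => h2 s, ← Finset.mul_sum, ← h1, mul_zero]

lemma rr_deg {r : GI (qc F) W → Polynomial F} {β : ℕ} (h : ∀ s, (r s).natDegree ≤ β) (ν : ℕ) (s : GI (qc F) W) :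
    (rr r ν s).natDegree ≤ β + W * qc F ^ (ν+1) := by
  induction ν generalizing s with
  | zero => exact (h s).trans (Nat.le_add_right _ _)
  | succ ν ih =>
    have hq := one_lt_qc (F := F)
    refine (Polynomial.natDegree_mul_le).trans ?_
    have h1 := PP_natDegree ih s
    have h2 : ((Polynomial.X - Polynomial.X ^ qc F ^ (ν+1) : Polynomial F) ^ (W - s.1.sum)).natDegree ≤ W * qc F ^ (ν+1) := by
      refine Polynomial.natDegree_pow_le.trans (Nat.mul_le_mul (Nat.sub_le _ _) ?_)
      refine (Polynomial.natDegree_sub_le _ _).trans ?_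
      rw [Polynomial.natDegree_X, Polynomial.natDegree_X_pow]
      exact max_le (one_lt_pow F ν).le le_rfl
    have h3 : 2 * (W * qc F ^ (ν+1)) ≤ W * qc F ^ (ν+1+1) := by
      rw [pow_succ _ (ν+1), mul_comm 2, ← mul_assoc W (qc F ^ (ν+1))]; exact Nat.mul_le_mul_left _ hq
    omega

/-- auxiliary polynomial at the twisted point -/
def Qh {D T : ℕ} (x : GI (qc F) W × Fin D × Fin T → F) (e : ℕ) (s : GI (qc F) W) : Polynomial F :=
  ∑ i : Fin D, ∑ j : Fin T, Polynomial.C (x (s, i, j)) * Polynomial.X ^ (e * (D - 1 - i) + j)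

lemma Qh_deg {D T : ℕ} (x : GI (qc F) W × Fin D × Fin T → F) (e : ℕ) (s : GI (qc F) W) :
    (Qh x e s).natDegree ≤ e * (D - 1) + T := by
  refine Polynomial.natDegree_sum_le_of_forall_le _ _ fun i _ => Polynomial.natDegree_sum_le_of_forall_le _ _ fun j _ => ?_
  refine (Polynomial.natDegree_C_mul_X_pow_le _ _).trans ?_
  have : e * (D - 1 - i) ≤ e * (D - 1) := Nat.mul_le_mul_left _ (Nat.sub_le _ _)
  have := j.2
  omega

lemma aux_exists {r : GI (qc F) W → Polynomial F} (hr : r ≠ 0) {β : ℕ} (hβ : ∀ s, (r s).natDegree ≤ β)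
    (h : ∑ s, ev F (r s) * yv 0 s = 0) {N D T : ℕ} (hD : 1 ≤ D)
    (hc : Fintype.card (GI (qc F) W) * ∑ ν ∈ Finset.range N, (qc F ^ (ν+1) * (D + W) + T + β) <
      Fintype.card (GI (qc F) W) * (D * T) + ∑ ν ∈ Finset.range N, (qc F ^ (ν+1) * (D + W) + T + β)) :
    ∃ x : GI (qc F) W × Fin D × Fin T → F, x ≠ 0 ∧ ∀ ν < N, ∑ s, ev F (Qh x (qc F ^ (ν+1)) s) * yv ν s = 0 := by
  choose st hst using rr_ne hr
  set E : ℕ → ℕ := fun ν => qc F ^ (ν+1) * (D + W) + T + β with hE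
  obtain ⟨x, hx0, hx⟩ := siegelP (F := F) (ι := GI (qc F) W × Fin D × Fin T) (κ := Fin N × GI (qc F) W)
    (fun x p => rr r p.1 (st p.1) * Qh x (qc F ^ (p.1.1+1)) p.2 - rr r p.1 p.2 * Qh x (qc F ^ (p.1.1+1)) (st p.1))
    (by
      intro x y p
      simp only [Qh, Pi.add_apply, map_add, add_mul, Finset.sum_add_distrib]
      ring)
    (by
      intro a x p
      simp only [Qh, Pi.smul_apply, smul_eq_mul, map_mul, Polynomial.smul_eq_C_mul, mul_assoc, ← Finset.mul_sum]
      ring)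
    (fun p => if p.2 = st p.1 then 0 else E p.1)
    (by
      intro x p m hm
      by_cases hp : p.2 = st p.1
      · rw [hp, sub_self, Polynomial.coeff_zero]
      · rw [if_neg hp] at hm
        apply Polynomial.coeff_eq_zero_of_natDegree_lt
        refine lt_of_lt_of_le ?_ hm
        have hq : 1 ≤ qc F ^ (p.1.1+1) := (one_lt_pow F p.1.1).le
        have key : ∀ a b, (rr r p.1 a * Qh x (qc F ^ (p.1.1+1)) b).natDegree ≤
            (β + W * qc F ^ (p.1.1+1)) + (qc F ^ (p.1.1+1) * (D-1) + T) := fun a b =>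
          Polynomial.natDegree_mul_le.trans (Nat.add_le_add (rr_deg hβ _ _) (Qh_deg _ _ _))
        refine lt_of_le_of_lt ((Polynomial.natDegree_sub_le _ _).trans (max_le (key _ _) (key _ _))) ?_
        obtain ⟨D', rfl⟩ := Nat.exists_eq_add_of_le hD
        simp only [hE, Nat.add_sub_cancel_left]
        nlinarith)
    (by
      rw [Fintype.card_prod, Fintype.card_prod, Fintype.card_fin, Fintype.card_fin, Fintype.sum_prod_type]
      have h1 : ∀ ν : Fin N, (∑ s : GI (qc F) W, if s = st ν then 0 else E ν) + E ν = Fintype.card (GI (qc F) W) * E ν := by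
        intro ν
        have : ∑ s : GI (qc F) W, (if s = st ν then E ν else 0) = E ν := by simp
        conv_lhs => rw [← this]
        rw [← Finset.sum_add_distrib]
        rw [Finset.sum_congr rfl (g := fun _ => E ν)]
        · simp
        · intro s _; split_ifs <;> simp_all
      have h2 : (∑ ν : Fin N, ∑ s : GI (qc F) W, if s = st ν then 0 else E ν) + ∑ ν : Fin N, E ν =
          Fintype.card (GI (qc F) W) * ∑ ν : Fin N, E ν := by
        rw [← Finset.sum_add_distrib, Finset.mul_sum]; exact Finset.sum_congr rfl fun ν _ => h1 ν
      rw [Fin.sum_univ_eq_sum_range (fun ν => E ν)] at h2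
      change _ + (Finset.range N).sum E = _ * (Finset.range N).sum E at h2
      change (∑ ν : Fin N, ∑ s : GI (qc F) W, if s = st ν then 0 else E ν) < _
      omega)
  refine ⟨x, hx0, fun ν hν => ?_⟩
  have h3 := rr_sum h ν
  have h4 : ev F (rr r ν (st ν)) ≠ 0 := fun h0 => hst ν (ev_inj F (by rw [h0, map_zero]))
  apply mul_left_cancel₀ h4
  rw [mul_zero, Finset.mul_sum, ← mul_zero (ev F (Qh x (qc F ^ (ν+1)) (st ν))), ← h3, Finset.mul_sum]
  refine Finset.sum_congr rfl fun s _ => ?_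
  have h5 := congrArg (ev F) (hx (⟨ν, hν⟩, s))
  simp only [map_sub, map_mul, map_zero] at h5
  linear_combination (yv ν s) * h5
end Transport

section Aux
open PowerSeries
variable {F : Type} [Field F] [Fintype F] {W : ℕ}

/-- auxiliary function -/
def auxf {D T : ℕ} (x : GI (qc F) W × Fin D × Fin T → F) : (Polynomial F)⟦X⟧ :=
  ∑ s : GI (qc F) W, (∑ i : Fin D, ∑ j : Fin T,
    C (Polynomial.C (x (s, i, j)) * Polynomial.X ^ (j : ℕ)) * X ^ (i : ℕ)) * LS (qc F) (Polynomial.X : Polynomial F) s.1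

lemma auxf_Ev {D T : ℕ} (x : GI (qc F) W × Fin D × Fin T → F) (ν : ℕ)
    (h : ∑ s, ev F (Qh x (qc F ^ (ν+1)) s) * yv ν s = 0) :
    Ev (qc F ^ (ν+1)) T (PowerSeries.map (ev F) (auxf x)) 0 := by
  set a := qc F ^ (ν+1) with ha
  have h1 : PowerSeries.map (ev F) (auxf x) = ∑ s : GI (qc F) W, (∑ i : Fin D, ∑ j : Fin T,
      C (ev F (Polynomial.C (x (s, i, j)) * Polynomial.X ^ (j : ℕ))) * X ^ (i : ℕ)) * LS (qc F) (thetaQ F) s.1 := by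
    simp only [auxf, map_sum, map_mul, map_pow, PowerSeries.map_C, PowerSeries.map_X, LS_map (ev F) (qc_ne F), ev_X]
  have h2 : Ev a T (PowerSeries.map (ev F) (auxf x)) (∑ s : GI (qc F) W, (∑ i : Fin D, ∑ j : Fin T,
      ev F (Polynomial.C (x (s, i, j)) * Polynomial.X ^ (j : ℕ)) * (thetaQ F ^ a)⁻¹ ^ (i : ℕ)) * yv ν s) := by
    rw [h1]
    refine Ev_sum _ fun s _ => ?_
    have h4 : ∀ (i : Fin D) (j : Fin T), Ev a T (C (ev F (Polynomial.C (x (s, i, j)) * Polynomial.X ^ (j : ℕ))) * X ^ (i : ℕ))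
        (ev F (Polynomial.C (x (s, i, j)) * Polynomial.X ^ (j : ℕ)) * (thetaQ F ^ a)⁻¹ ^ (i : ℕ)) := by
      intro i j
      have h3 := Ev_mul (Ev_C (F := F) a (B := T) (y := ev F (Polynomial.C (x (s, i, j)) * Polynomial.X ^ (j : ℕ))) ?_)
        (Ev_pow (Ev_X a) i)
      · rw [add_zero] at h3; exact h3
      · rw [ev_dle F]
        intro m hm
        rw [Polynomial.coeff_C_mul_X_pow, if_neg]
        have := j.2
        omega
    have := Ev_mul (Ev_sum Finset.univ fun i _ => Ev_sum Finset.univ fun j _ => h4 i j) (Ev_LS (F := F) ν s.2.1)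
    rw [add_zero] at this; exact this
  convert h2 using 1
  symm
  have hth : thetaQ F ≠ 0 := theta_ne
  have h4 : (thetaQ F ^ a) ^ (D-1) ≠ 0 := pow_ne_zero _ (pow_ne_zero _ hth)
  apply mul_left_cancel₀ h4
  rw [mul_zero, ← h, Finset.mul_sum]
  refine Finset.sum_congr rfl fun s _ => ?_
  rw [← mul_assoc]
  congr 1
  simp only [Qh, map_sum, Finset.mul_sum]
  refine Finset.sum_congr rfl fun i _ => Finset.sum_congr rfl fun j _ => ?_
  have hi : D - 1 = (D - 1 - i) + i := by have := i.2; omega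
  have h5 : (thetaQ F ^ a) ^ (D-1) = (thetaQ F ^ a) ^ (D-1-i) * (thetaQ F ^ a) ^ (i:ℕ) := by
    rw [← pow_add, ← hi]
  have h6 : (thetaQ F ^ a) ^ (i:ℕ) * ((thetaQ F ^ a)⁻¹) ^ (i : ℕ) = 1 := by
    rw [← mul_pow, mul_inv_cancel₀ (pow_ne_zero _ hth), one_pow]
  simp only [map_mul, map_pow, ev_X, pow_add, pow_mul]
  rw [h5]
  linear_combination (ev F (Polynomial.C (x (s, i, j))) * thetaQ F ^ (j:ℕ) * (thetaQ F ^ a) ^ (D-1-i)) * h6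

lemma auxf_ne {D T : ℕ} (x : GI (qc F) W × Fin D × Fin T → F) (hx : x ≠ 0) :
    ∃ k ≤ Fintype.card (GI (qc F) W) * (qc F ^ Fintype.card (GI (qc F) W) * (D + W)), coeff k (auxf x) ≠ 0 := by
  obtain ⟨⟨s1, i1, j1⟩, h1⟩ := Function.ne_iff.1 hx
  have hex : ∃ j : ℕ, ∃ (hj : j < T) (s : GI (qc F) W) (i : Fin D), x (s, i, ⟨j, hj⟩) ≠ 0 := ⟨j1, j1.2, s1, i1, h1⟩
  set j0 := Nat.find hex with hj0
  obtain ⟨hjT, s0, i0, hx0⟩ := Nat.find_spec hex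
  have hmin : ∀ (s : GI (qc F) W) (i : Fin D) (j : Fin T), (j : ℕ) < j0 → x (s, i, j) = 0 := by
    intro s i j hj
    have := Nat.find_min hex hj
    by_contra hne
    exact this ⟨j.2, s, i, hne⟩
  set g : (Polynomial F)⟦X⟧ := ∑ s : GI (qc F) W, (∑ i : Fin D, ∑ j : Fin T,
    C (Polynomial.C (x (s, i, j)) * Polynomial.X ^ ((j : ℕ) - j0)) * X ^ (i : ℕ)) * LS (qc F) (Polynomial.X : Polynomial F) s.1 with hg
  have hfg : auxf x = C (Polynomial.X ^ j0) * g := by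
    rw [auxf, hg, Finset.mul_sum]
    refine Finset.sum_congr rfl fun s _ => ?_
    rw [← mul_assoc, Finset.mul_sum]
    congr 1
    refine Finset.sum_congr rfl fun i _ => ?_
    rw [Finset.mul_sum]
    refine Finset.sum_congr rfl fun j _ => ?_
    rw [← mul_assoc, ← map_mul]
    congr 2
    rcases lt_or_ge (j : ℕ) j0 with hlt | hge
    · rw [hmin s i j hlt]; simp
    · rw [mul_left_comm, ← pow_add, Nat.add_sub_cancel' hge]
  set c : GI (qc F) W → Polynomial F := fun s => ∑ i : Fin D, Polynomial.C (x (s, i, ⟨j0, hjT⟩)) * Polynomial.X ^ (i : ℕ) with hc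
  have hcc : ∀ s (i : Fin D), (c s).coeff i = x (s, i, ⟨j0, hjT⟩) := by
    intro s i
    rw [hc]
    simp only [Polynomial.finsetSum_coeff, Polynomial.coeff_C_mul_X_pow]
    rw [Finset.sum_eq_single i]
    · simp
    · intro b _ hb; rw [if_neg]; intro h; exact hb (Fin.ext h.symm)
    · simp
  have hc0 : c ≠ 0 := by
    intro h
    apply hx0
    rw [← hcc, h]; simp
  obtain ⟨k, hk, hne⟩ := zero_est D c hc0 (fun s => by
    refine Polynomial.natDegree_sum_le_of_forall_le _ _ fun i _ => ?_
    exact (Polynomial.natDegree_C_mul_X_pow_le _ _).trans i.2.le)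
  refine ⟨k, hk, fun h0 => hne ?_⟩
  rw [hfg, coeff_C_mul] at h0
  have hgk : coeff k g = 0 := by
    rcases mul_eq_zero.1 h0 with h | h
    · exact absurd h (pow_ne_zero _ Polynomial.X_ne_zero)
    · exact h
  have hmap : PowerSeries.map (Polynomial.evalRingHom (0:F)) g = ∑ s, ((c s : Polynomial F) : F⟦X⟧) * LS (qc F) (0:F) s.1 := by
    rw [hg, map_sum]
    refine Finset.sum_congr rfl fun s _ => ?_
    rw [map_mul, LS_map _ (qc_ne F)]
    congr 1
    · have : ((c s : Polynomial F) : F⟦X⟧) = ∑ i : Fin D, C (x (s, i, ⟨j0, hjT⟩)) * X ^ (i : ℕ) := by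
        rw [← Polynomial.coeToPowerSeries.ringHom_apply, hc, map_sum]
        refine Finset.sum_congr rfl fun i _ => ?_
        rw [map_mul, map_pow]
        simp [Polynomial.coeToPowerSeries.ringHom_apply]
      rw [this, map_sum]
      refine Finset.sum_congr rfl fun i _ => ?_
      rw [map_sum, Finset.sum_eq_single (⟨j0, hjT⟩ : Fin T)]
      · simp
      · intro j _ hj
        rcases lt_or_ge (j : ℕ) j0 with hlt | hge
        · rw [hmin s i j hlt]; simp
        · have : (j : ℕ) - j0 ≠ 0 := by
            have : (j : ℕ) ≠ j0 := fun h => hj (Fin.ext h)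
            omega
          simp [this]
      · simp
    · simp
  rw [← hmap, coeff_map, hgk, map_zero]

lemma exists_N (c : ℕ) : ∃ N, 1 ≤ N ∧ c * N ^ 2 < 2 ^ N := by
  refine ⟨8 * (c+2), by omega, ?_⟩
  have h1 : c + 2 < 2 ^ (c+2) := Nat.lt_two_pow_self
  have h2 : 64 ≤ 2 ^ (5 * (c+2)) := by
    calc 64 = 2 ^ 6 := by norm_num
      _ ≤ _ := Nat.pow_le_pow_right (by norm_num) (by omega)
  calc c * (8 * (c+2)) ^ 2 ≤ 64 * (c+2)^3 := by nlinarith [sq_nonneg (c+2)]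
    _ < 64 * (2 ^ (c+2)) ^ 3 := by
        have := Nat.pow_lt_pow_left h1 (show 3 ≠ 0 by norm_num)
        omega
    _ ≤ 2 ^ (5 * (c+2)) * (2 ^ (c+2)) ^ 3 := Nat.mul_le_mul_right _ h2
    _ = _ := by rw [← pow_mul, ← pow_add]; congr 1; ring

theorem indep (r : GI (qc F) W → Polynomial F) (h : ∑ s, ev F (r s) * yv 0 s = 0) : r = 0 := by
  by_contra hr
  obtain ⟨β, hβ⟩ : ∃ β, ∀ s, (r s).natDegree ≤ β :=
    ⟨∑ s, (r s).natDegree, fun s => Finset.single_le_sum (f := fun s => (r s).natDegree) (fun _ _ => Nat.zero_le _) (Finset.mem_univ s)⟩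
  set n := Fintype.card (GI (qc F) W) with hn
  obtain ⟨s0, _⟩ := Function.ne_iff.1 hr
  have hn1 : 1 ≤ n := Fintype.card_pos_iff.2 ⟨s0⟩
  set A := n * (W + 1) + 1 with hA
  set p := qc F ^ n with hp
  obtain ⟨N, hN1, hN⟩ := exists_N (n * A * (2 + n * (p * (A + W))) + n * β)
  set D := n * (W + N) + 1 with hD
  set κ := n * (p * (D + W)) with hκ
  set L := N + κ + 1 with hL
  set Γ := ∑ ν ∈ Finset.range N, qc F ^ (ν+1) with hΓ
  have hDA : D ≤ A * N := by
    rw [hD, hA]; nlinarith [Nat.mul_le_mul_left (n*W) hN1]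
  have hLN : L ≤ (2 + n * (p * (A + W))) * N := by
    have : D + W ≤ (A + W) * N := by nlinarith [Nat.mul_le_mul_left W hN1]
    have : κ ≤ n * (p * ((A + W) * N)) := Nat.mul_le_mul_left _ (Nat.mul_le_mul_left _ this)
    rw [hL]; nlinarith
  have hbig : n * D * L + n * N * β < Γ := by
    have h1 : n * D * L ≤ n * (A * N) * ((2 + n * (p * (A + W))) * N) :=
      Nat.mul_le_mul (Nat.mul_le_mul_left _ hDA) hLN
    have h2 : n * N * β ≤ n * β * N ^ 2 := by
      calc n * N * β = n * β * N * 1 := by ring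
        _ ≤ n * β * N * N := Nat.mul_le_mul_left _ hN1
        _ = _ := by ring
    have h3 : 2 ^ N ≤ Γ := by
      obtain ⟨M, rfl⟩ := Nat.exists_eq_add_of_le' hN1
      calc 2 ^ (M+1) ≤ qc F ^ (M+1) := Nat.pow_le_pow_left (one_lt_qc (F := F)) _
        _ ≤ Γ := Finset.single_le_sum (f := fun ν => qc F ^ (ν+1)) (fun _ _ => Nat.zero_le _)
            (Finset.mem_range.2 (Nat.lt_succ_self M))
    calc _ ≤ n * (A * N) * ((2 + n * (p * (A + W))) * N) + n * β * N ^ 2 := Nat.add_le_add h1 h2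
      _ = (n * A * (2 + n * (p * (A + W))) + n * β) * N ^ 2 := by ring
      _ < 2 ^ N := hN
      _ ≤ Γ := h3
  have hD1 : 1 ≤ D := by omega
  have hLΓ : L < Γ := by
    have : 1 * 1 * L ≤ n * D * L := Nat.mul_le_mul_right _ (Nat.mul_le_mul hn1 hD1)
    omega
  obtain ⟨T, hT⟩ := Nat.exists_eq_add_of_lt hLΓ
  have hsum : ∑ ν ∈ Finset.range N, (qc F ^ (ν+1) * (D + W) + (T+1) + β) = Γ * (D + W) + N * (T + 1 + β) := by
    simp only [add_assoc _ (T+1) β]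
    rw [Finset.sum_add_distrib, ← Finset.sum_mul, ← hΓ]; simp
  obtain ⟨x, hx0, hx⟩ := aux_exists hr hβ h (N := N) (D := D) (T := T+1) hD1 (by
    rw [hsum, ← hn]
    obtain ⟨n', hn'⟩ := Nat.exists_eq_add_of_le' hn1
    have hT' : Γ = L + (T + 1) := by omega
    rw [hn'] at hbig hD ⊢
    generalize hT1 : T + 1 = T1 at *
    have e1 : (n'+1) * D * L + (n'+1) * N * β < L + T1 := by rw [← hT']; exact hbig
    rw [hT']
    have e3 : (n'+1) * D * T1 + (n'+1) * D * L = (n'+1) * D * (L + T1) := by ring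
    have e4 : (n'+1) * D * (L+T1) = n' * D * (L+T1) + D * (L+T1) := by ring
    have e5 : D * (L+T1) = (n'+1) * (W+N) * (L+T1) + (L+T1) := by rw [hD]; ring
    have e6 : (n'+1) * (W+N) * (L+T1) = n' * (W+N) * (L+T1) + (W+N) * (L+T1) := by ring
    have e7 : n' * ((L+T1)*(D+W) + N * (T1 + β)) + n' * N * L = n' * D * (L+T1) + n' * (W+N) * (L+T1) + n' * N * β := by ring
    have e8 : (n'+1) * N * β = n' * N * β + N * β := by ring
    have e9 : (n'+1) * ((L+T1)*(D+W) + N * (T1 + β)) = n' * ((L+T1)*(D+W) + N * (T1 + β)) + ((L+T1)*(D+W) + N * (T1 + β)) := by ring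
    have e10 : (n'+1) * (D * T1) = (n'+1) * D * T1 := by ring
    rw [e9, e10]
    have : 0 ≤ n' * N * L := Nat.zero_le _
    have : 0 ≤ (W+N) * (L+T1) := Nat.zero_le _
    have : 0 ≤ N * β := Nat.zero_le _
    linarith)
  obtain ⟨k, hk, hk0⟩ := auxf_ne x hx0
  have hqi : ∀ i, 2 ≤ qc F ^ (i+1) := one_lt_pow F
  have := final_bound (auxf_Ev x 0 (hx 0 hN1)).1 (fun ν => qc F ^ (ν+1)) hqi
    (fun a b hab => by
      have := Nat.pow_right_injective (one_lt_qc (F := F)) hab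
      omega) N
    (fun ν hν => ⟨_, by have := (auxf_Ev x ν (hx ν hν)).2.2; rwa [map_zero, sub_zero] at this⟩) hk0
  rw [Finset.sum_sub_distrib] at this
  have hc : ∑ ν ∈ Finset.range N, ((qc F ^ (ν+1) : ℕ) : ℤ) = (Γ : ℤ) := by rw [hΓ, Nat.cast_sum]
  rw [hc] at this
  simp only [Finset.sum_const, Finset.card_range, nsmul_eq_mul, mul_one] at this
  have hk' : k ≤ κ := hk
  push_cast at this
  omega
end Aux

section Uniq
variable {F : Type} [Field F] [Fintype F]

lemma Ksub_frac {y : KinfQ F} (hy : y ∈ Ksub F) : ∃ d p : Polynomial F, d ≠ 0 ∧ ev F d * y = ev F p := by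
  have hne : ∀ {d : Polynomial F}, d ≠ 0 → ev F d ≠ 0 := fun hd h => hd (ev_inj F (by rw [h, map_zero]))
  induction hy using Subfield.closure_induction with
  | mem y hy =>
    rcases hy with ⟨c, rfl⟩ | hy
    · exact ⟨1, Polynomial.C c, one_ne_zero, by simp [ev_C]⟩
    · rw [Set.mem_singleton_iff] at hy
      exact ⟨1, Polynomial.X, one_ne_zero, by simp [ev_X, hy]⟩
  | one => exact ⟨1, 1, one_ne_zero, by simp⟩
  | add x y _ _ hx hy =>
    obtain ⟨d, p, hd, h⟩ := hx
    obtain ⟨d', p', hd', h'⟩ := hy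
    refine ⟨d * d', p * d' + p' * d, mul_ne_zero hd hd', ?_⟩
    simp only [map_mul, map_add]
    linear_combination ev F d' * h + ev F d * h'
  | neg x _ hx =>
    obtain ⟨d, p, hd, h⟩ := hx
    refine ⟨d, -p, hd, ?_⟩
    rw [map_neg]; linear_combination -h
  | inv x _ hx =>
    obtain ⟨d, p, hd, h⟩ := hx
    rcases eq_or_ne x 0 with h0 | h0
    · exact ⟨1, 0, one_ne_zero, by simp [h0]⟩
    · refine ⟨p, d, ?_, ?_⟩
      · rintro rfl
        rw [map_zero] at h
        exact mul_ne_zero (hne hd) h0 h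
      · rw [← h, mul_assoc, mul_inv_cancel₀ h0, mul_one]
  | mul x y _ _ hx hy =>
    obtain ⟨d, p, hd, h⟩ := hx
    obtain ⟨d', p', hd', h'⟩ := hy
    refine ⟨d * d', p * p', mul_ne_zero hd hd', ?_⟩
    simp only [map_mul]
    rw [← h, ← h']; ring

lemma common_den {ι : Type} [Fintype ι] (b : ι → KinfQ F) (hb : ∀ t, b t ∈ Ksub F) :
    ∃ (d : Polynomial F) (P : ι → Polynomial F), d ≠ 0 ∧ ∀ t, ev F d * b t = ev F (P t) := by
  choose d p hd h using fun t => Ksub_frac (hb t)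
  refine ⟨∏ t, d t, fun t => p t * ∏ u ∈ Finset.univ.erase t, d u, Finset.prod_ne_zero_iff.2 fun t _ => hd t, fun t => ?_⟩
  rw [← Finset.mul_prod_erase _ _ (Finset.mem_univ t), map_mul, map_mul, ← h]; ring

/-- index embedding -/
def emb {w : ℕ} (t : STup (qc F) w) : GI (qc F) w :=
  ⟨(List.ofFn t.1.2).reverse, by
    refine ⟨fun k hk => ?_, fun k hk => ?_, ?_⟩
    · rw [List.mem_reverse, List.mem_ofFn] at hk
      obtain ⟨i, rfl⟩ := hk
      exact t.2.2.1 i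
    · rw [List.mem_reverse, List.mem_ofFn] at hk
      obtain ⟨i, rfl⟩ := hk
      exact t.2.2.2.2 i
    · rw [List.sum_reverse, STup_sum]⟩

lemma emb_inj {w : ℕ} : Function.Injective (emb (F := F) (w := w)) := by
  intro a b h
  apply STup_inj
  exact List.reverse_injective (congrArg Subtype.val h)

lemma uniq (w : ℕ) (b : STup (qc F) w → KinfQ F) (hb : ∀ t, b t ∈ Ksub F)
    (h : ∑' t : STup (qc F) w, b t * LiQ F t.1.1 t.1.2 = 0) : ∀ t, b t = 0 := by
  letI : Fintype (STup (qc F) w) := Fintype.ofFinite _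
  rw [tsum_fintype] at h
  obtain ⟨d, P, hd, hP⟩ := common_den b hb
  have hr := indep (W := w) (Function.extend emb P 0) (by
    rw [← Fintype.sum_of_injective emb emb_inj (fun t => ev F d * (b t * LiQ F t.1.1 t.1.2))]
    · rw [← Finset.mul_sum, h, mul_zero]
    · intro s hs
      rw [Function.extend_apply' _ _ _ (fun ⟨t, ht⟩ => hs ⟨t, ht⟩)]; simp
    · intro t
      rw [emb_inj.extend_apply, ← hP, LiQ_STup, yv]
      simp only [emb, List.reverse_reverse]; ring)
  intro t
  have h1 := congrFun hr (emb t)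
  rw [emb_inj.extend_apply, Pi.zero_apply] at h1
  have h2 := hP t
  rw [h1, map_zero] at h2
  rcases mul_eq_zero.1 h2 with h3 | h3
  · exact absurd (ev_inj F (by rw [h3, map_zero])) hd
  · exact h3
end Uniq

/-- **Relation with the Carlitz period, case `N = 1`** (Lemma `relation Carlitz period`
together with the uniqueness from Theorem `trans CMPL at roots of unity`): if
`(q-1) ∣ w`, there exist unique `a_𝔰 ∈ K` (`𝔰 ∈ S_w`) with
`ϖ^{w/(q-1)} + Σ_{𝔰 ∈ S_w} a_𝔰·Li(𝔰) = 0`. -/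
theorem carlitz_period_relation
    (Fq : Type) [Field Fq] [Fintype Fq] (w : ℕ) (hw : 0 < w) (hdvd : (qc Fq - 1) ∣ w) :
    ∃! a : STup (qc Fq) w → KinfQ Fq,
      (∀ t, a t ∈ Ksub Fq) ∧
      piQ Fq ^ (w / (qc Fq - 1)) + ∑' t : STup (qc Fq) w, a t * LiQ Fq t.1.1 t.1.2 = 0 := by
  obtain ⟨a, ha, h⟩ := existence (F := Fq) w hw hdvd
  refine ⟨a, ⟨ha, h⟩, ?_⟩
  rintro b ⟨hb, h'⟩
  have h3 := uniq (F := Fq) w (fun t => b t - a t) (fun t => sub_mem (hb t) (ha t)) (by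
    letI : Fintype (STup (qc Fq) w) := Fintype.ofFinite _
    rw [tsum_fintype] at h h' ⊢
    simp only [sub_mul, Finset.sum_sub_distrib]
    linear_combination h' - h)
  funext t
  exact sub_eq_zero.1 (h3 t)

end ZHPC
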